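/- arXiv:math/0508409 — 7 statements merged into one kernel-verified Lean document; each statement's English description precedes it below -/
import Mathlib

section
/- Let p ≥ 5 be a prime, m an integer with p ∤ m, and m' a positive integer with m'·m ≡ 1 (mod p). Then Σ_{j∈R_p(m)} 1/[j]_{q^2} ≡ (|R_p(m)|/2)·(1−q^2) + (1+q^{m'})·Q_p(2,q^{m'})/(2[m']_{q^2}) − ((1+q)/2)·Q_p(2,q) (mod [p]_q). -/
open Polynomial Finset

/-- The indeterminate `q` as an element of the rational function field `ℚ(q)`. -/
noncomputable def q : RatFunc ℚ := algebraMap (Polynomial ℚ) (RatFunc ℚ) Polynomial.X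

/-- The `q`-integer `[n]_a = 1 + a + ⋯ + a^(n-1)` with base `a ∈ ℚ(q)`. -/
noncomputable def qn (a : RatFunc ℚ) (n : ℕ) : RatFunc ℚ := ∑ i ∈ Finset.range n, a ^ i

/-- The `q`-Pochhammer symbol `(x; a)_n = ∏_{i=0}^{n-1} (1 - x a^i)`. -/
noncomputable def qpoch (x a : RatFunc ℚ) (n : ℕ) : RatFunc ℚ :=
  ∏ i ∈ Finset.range n, (1 - x * a ^ i)

/-- The Gaussian binomial coefficient `[n choose k]_a = (a;a)_n / ((a;a)_k (a;a)_{n-k})`. -/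
noncomputable def qbinom (a : RatFunc ℚ) (n k : ℕ) : RatFunc ℚ :=
  qpoch a a n / (qpoch a a k * qpoch a a (n - k))

/-- The polynomial `q`-integer `[n]_a = 1 + a + ⋯ + a^(n-1)` with base `a ∈ ℚ[q]`. -/
noncomputable def pqn (a : Polynomial ℚ) (n : ℕ) : Polynomial ℚ := ∑ i ∈ Finset.range n, a ^ i

/-- `A ≡ B (mod g)`: the rational function `(A - B)/g`, written in lowest terms,
has denominator coprime to `g`. -/
def qCong (g : Polynomial ℚ) (A B : RatFunc ℚ) : Prop :=
  IsCoprime (((A - B) / algebraMap (Polynomial ℚ) (RatFunc ℚ) g).denom) g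

/-- The `q`-Fermat quotient `Q_p(m, a) = ((a^m; a^m)_{p-1} / (a; a)_{p-1} - 1) / [p]_a`. -/
noncomputable def QF (p m : ℕ) (a : RatFunc ℚ) : RatFunc ℚ :=
  (qpoch (a ^ m) (a ^ m) (p - 1) / qpoch a a (p - 1) - 1) / qn a p

/-- `⟨x⟩_p`: the least non-negative residue of the integer `x` modulo `p`. -/
def res (p : ℕ) (x : ℤ) : ℕ := (x % (p : ℤ)).toNat

/-- `R_p(m) = {j : 1 ≤ j < p/2, ⟨jm⟩_p > p/2}` (for odd `p`, `1 ≤ j < p/2` means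
`1 ≤ j ≤ (p-1)/2`, and `⟨jm⟩_p > p/2` means `2⟨jm⟩_p > p`). -/
def Rset (p : ℕ) (m : ℤ) : Finset ℕ :=
  (Finset.Icc 1 ((p - 1) / 2)).filter fun j => p < 2 * res p ((j : ℤ) * m)

/-- The rational function `A` is regular at `ζ`, with value `z` there. -/
def HasValue (ζ : ℂ) (A : RatFunc ℚ) (z : ℂ) : Prop :=
  ∃ N D : ℚ[X], aeval ζ D ≠ 0 ∧
    A * algebraMap ℚ[X] (RatFunc ℚ) D = algebraMap ℚ[X] (RatFunc ℚ) N ∧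
    aeval ζ N = z * aeval ζ D

namespace HasValue

variable {ζ : ℂ} {A B : RatFunc ℚ} {z w : ℂ}

theorem ofPolynomial (P : ℚ[X]) :
    HasValue ζ (algebraMap ℚ[X] (RatFunc ℚ) P) (aeval ζ P) :=
  ⟨P, 1, by simp, by simp, by simp⟩

theorem q : HasValue ζ q ζ := by
  simpa [_root_.q] using ofPolynomial (ζ := ζ) X

theorem natCast (n : ℕ) : HasValue ζ (n : RatFunc ℚ) n := by
  simpa using ofPolynomial (ζ := ζ) (n : ℚ[X])

theorem one : HasValue ζ 1 1 := by simpa using natCast (ζ := ζ) 1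

theorem two : HasValue ζ 2 2 := by simpa using natCast (ζ := ζ) 2

theorem add (hA : HasValue ζ A z) (hB : HasValue ζ B w) : HasValue ζ (A + B) (z + w) := by
  obtain ⟨N, D, hD, h, e⟩ := hA
  obtain ⟨N', D', hD', h', e'⟩ := hB
  refine ⟨N * D' + N' * D, D * D', by simp [hD, hD'], ?_, ?_⟩
  · simp only [map_mul, map_add]
    linear_combination (algebraMap ℚ[X] (RatFunc ℚ) D') * h +
      (algebraMap ℚ[X] (RatFunc ℚ) D) * h'
  · simp only [map_mul, map_add]
    linear_combination aeval ζ D' * e + aeval ζ D * e'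

theorem mul (hA : HasValue ζ A z) (hB : HasValue ζ B w) : HasValue ζ (A * B) (z * w) := by
  obtain ⟨N, D, hD, h, e⟩ := hA
  obtain ⟨N', D', hD', h', e'⟩ := hB
  refine ⟨N * N', D * D', by simp [hD, hD'], ?_, ?_⟩
  · simp only [map_mul, ← h, ← h']
    ring
  · simp only [map_mul, e, e']
    ring

theorem neg (hA : HasValue ζ A z) : HasValue ζ (-A) (-z) := by
  obtain ⟨N, D, hD, h, e⟩ := hA
  exact ⟨-N, D, hD, by simp [← h], by simp [e]⟩

theorem sub (hA : HasValue ζ A z) (hB : HasValue ζ B w) : HasValue ζ (A - B) (z - w) := by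
  simpa [sub_eq_add_neg] using hA.add hB.neg

theorem inv (hA : HasValue ζ A z) (hz : z ≠ 0) : HasValue ζ A⁻¹ z⁻¹ := by
  obtain ⟨N, D, hD, h, e⟩ := hA
  have hN : aeval ζ N ≠ 0 := by simp [e, hz, hD]
  refine ⟨D, N, hN, ?_, by rw [e]; field_simp⟩
  have hA0 : A ≠ 0 := by
    rintro rfl
    have : N = 0 := RatFunc.algebraMap_injective ℚ (by simpa using h.symm)
    exact hN (by simp [this])
  rw [← h]
  field_simp

theorem div (hA : HasValue ζ A z) (hB : HasValue ζ B w) (hw : w ≠ 0) :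
    HasValue ζ (A / B) (z / w) := by
  simpa [div_eq_mul_inv] using hA.mul (hB.inv hw)

theorem pow (hA : HasValue ζ A z) (n : ℕ) : HasValue ζ (A ^ n) (z ^ n) := by
  induction n with
  | zero => simpa using one
  | succ n ih => simpa [pow_succ] using ih.mul hA

theorem sum {ι : Type*} (s : Finset ι) {f : ι → RatFunc ℚ} {g : ι → ℂ}
    (h : ∀ i ∈ s, HasValue ζ (f i) (g i)) : HasValue ζ (∑ i ∈ s, f i) (∑ i ∈ s, g i) := by
  classical
  induction s using Finset.induction_on with
  | empty => simpa using natCast 0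
  | insert a s ha ih =>
    rw [Finset.sum_insert ha, Finset.sum_insert ha]
    exact (h a (by simp)).add (ih fun i hi => h i (by simp [hi]))

theorem qn (hA : HasValue ζ A z) (n : ℕ) : HasValue ζ (qn A n) (∑ i ∈ range n, z ^ i) :=
  sum _ fun i _ => hA.pow i

end HasValue

theorem pqn_X_eq_minpoly {p : ℕ} (hp : p.Prime) {ζ : ℂ} (hζ : IsPrimitiveRoot ζ p) :
    pqn X p = minpoly ℚ ζ := by
  have := Fact.mk hp
  rw [← cyclotomic_eq_minpoly_rat hζ hp.pos, cyclotomic_prime, pqn]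

theorem qCong_of_hasValue {p : ℕ} (hp : p.Prime) {ζ : ℂ} (hζ : IsPrimitiveRoot ζ p)
    {A B : RatFunc ℚ} {z w : ℂ} (hA : HasValue ζ A z) (hB : HasValue ζ B w) (hzw : z = w) :
    qCong (pqn X p) A B := by
  subst hzw
  obtain ⟨N, D, hD, h, e⟩ := hA.sub hB
  have hint : IsIntegral ℚ ζ := (hζ.isIntegral hp.pos).tower_top
  rw [qCong, pqn_X_eq_minpoly hp hζ]
  obtain ⟨C, rfl⟩ : minpoly ℚ ζ ∣ N := minpoly.dvd ℚ ζ (by simpa using e)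
  have hD0 : D ≠ 0 := by rintro rfl; simp at hD
  have hm0 := minpoly.ne_zero hint
  have hinj := RatFunc.algebraMap_injective ℚ
  have hD' : algebraMap ℚ[X] (RatFunc ℚ) D ≠ 0 := by simpa using hD0
  have hm' : algebraMap ℚ[X] (RatFunc ℚ) (minpoly ℚ ζ) ≠ 0 := by simpa using hm0
  have key : (A - B) / algebraMap ℚ[X] (RatFunc ℚ) (minpoly ℚ ζ) =
      algebraMap ℚ[X] (RatFunc ℚ) C / algebraMap ℚ[X] (RatFunc ℚ) D := by
    rw [div_eq_div_iff hm' hD', h, map_mul, mul_comm]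
  rw [key]
  refine IsCoprime.of_isCoprime_of_dvd_left ?_ (RatFunc.denom_div_dvd C D)
  refine (((minpoly.irreducible hint).coprime_iff_not_dvd).2 fun hdvd => hD ?_).symm
  obtain ⟨E, rfl⟩ := hdvd
  simp

section CharacterSums

variable {p : ℕ} [Fact p.Prime] (ψ : AddChar (ZMod p) ℂ)

/-- The sum `∑ b, b ψ(c b) / (1 + ψ(c b))` over the least non-negative residues `b`. Multiplied by
`(ψ c - 1) / p`, it is the value of the `q`-Fermat quotient to base two at `ψ c`. -/
noncomputable def weightedSum (c : ZMod p) : ℂ :=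
  ∑ b : ZMod p, (b.val : ℂ) * (ψ (c * b) / (1 + ψ (c * b)))

theorem sum_mul_left {M : Type*} [AddCommMonoid M] {c : ZMod p} (hc : c ≠ 0) (f : ZMod p → M) :
    ∑ b, f (c * b) = ∑ b, f b :=
  Equiv.sum_comp (Equiv.mulLeft₀ c hc) f

theorem two_ne_zero_zmod (hp2 : p ≠ 2) : (2 : ZMod p) ≠ 0 := by
  intro h
  have : ((2 : ℕ) : ZMod p) = 0 := by simpa using h
  rw [ZMod.natCast_eq_zero_iff] at this
  exact hp2 ((Nat.prime_dvd_prime_iff_eq Fact.out Nat.prime_two).1 this)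

theorem one_add_addChar_ne_zero (hp2 : p ≠ 2) (hψ : ∀ a, a ≠ 0 → ψ a ≠ 1) (b : ZMod p) :
    1 + ψ b ≠ 0 := by
  intro h
  have h1 : ψ b = -1 := by linear_combination h
  have h2 : ψ (b + b) = 1 := by rw [AddChar.map_add_eq_mul, h1]; norm_num
  have hb : b ≠ 0 := by rintro rfl; simp at h
  refine hψ _ ?_ h2
  rw [← two_mul]
  exact mul_ne_zero (two_ne_zero_zmod hp2) hb

theorem val_two_mul (hp2 : p ≠ 2) (b : ZMod p) :
    (((2 * b).val : ℕ) : ℂ) = 2 * b.val - p * if p < 2 * b.val then 1 else 0 := by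
  have hlt := ZMod.val_lt b
  have hodd := (Fact.out : p.Prime).eq_two_or_odd.resolve_left hp2
  rw [two_mul, ZMod.val_add]
  split_ifs with h
  · have : (b.val + b.val) % p = b.val + b.val - p := by
      rw [Nat.mod_eq_sub_mod (by omega), Nat.mod_eq_of_lt (by omega)]
    rw [this, Nat.cast_sub (by omega)]
    push_cast
    ring
  · rw [Nat.mod_eq_of_lt (by omega)]
    push_cast
    ring

theorem lt_two_mul_val_neg (hp2 : p ≠ 2) {b : ZMod p} (hb : b ≠ 0) :
    p < 2 * (-b).val ↔ ¬ p < 2 * b.val := by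
  have hlt := ZMod.val_lt b
  have hodd := (Fact.out : p.Prime).eq_two_or_odd.resolve_left hp2
  rw [ZMod.neg_val, if_neg hb]
  omega

/-- The odd part `1 / (1 - ψ b) - 1 / 2` of `1 / (1 - ψ b)`. -/
noncomputable def oddPart (b : ZMod p) : ℂ := 1 / (1 - ψ b) - 1 / 2

theorem oddPart_neg (hψ : ∀ a, a ≠ 0 → ψ a ≠ 1) {b : ZMod p} (hb : b ≠ 0) :
    oddPart ψ (-b) = -oddPart ψ b := by
  have h1 : 1 - ψ b ≠ 0 := sub_ne_zero.2 (hψ b hb).symm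
  have h2 : 1 - ψ (-b) ≠ 0 := sub_ne_zero.2 (hψ _ (neg_ne_zero.2 hb)).symm
  have h3 : ψ b * ψ (-b) = 1 := by rw [← AddChar.map_add_eq_mul]; simp
  rw [oddPart, oddPart]
  field_simp
  linear_combination (-2) * h3

theorem div_one_add_addChar (hp2 : p ≠ 2) (hψ : ∀ a, a ≠ 0 → ψ a ≠ 1) {b : ZMod p} (hb : b ≠ 0) :
    ψ b / (1 + ψ b) = oddPart ψ b - 2 * oddPart ψ (2 * b) + 1 / 2 := by
  have h1 : 1 - ψ b ≠ 0 := sub_ne_zero.2 (hψ b hb).symm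
  have h2 := one_add_addChar_ne_zero ψ hp2 hψ b
  have h3 : ψ (2 * b) = ψ b * ψ b := by rw [two_mul, AddChar.map_add_eq_mul]
  have h4 : 1 - ψ b * ψ b = (1 - ψ b) * (1 + ψ b) := by ring
  rw [oddPart, oddPart, h3, h4]
  field_simp
  ring

theorem weightedSum_eq (hp2 : p ≠ 2) (hψ : ∀ a, a ≠ 0 → ψ a ≠ 1) {m c : ZMod p}
    (hmc : m * c = 1) :
    weightedSum ψ c = 1 / 2 * ∑ b : ZMod p, (b.val : ℂ) -
      p * ∑ b : ZMod p, (if p < 2 * (m * b).val then 1 else 0) * oddPart ψ (2 * b) := by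
  have hm : m ≠ 0 := left_ne_zero_of_mul_eq_one hmc
  have h1 : weightedSum ψ c = ∑ b : ZMod p, ((m * b).val : ℂ) * (ψ b / (1 + ψ b)) := by
    rw [weightedSum, ← sum_mul_left hm]
    refine Finset.sum_congr rfl fun b _ => ?_
    rw [← mul_assoc, mul_comm c m, hmc, one_mul]
  have h2 : ∀ b : ZMod p, ((m * b).val : ℂ) * (ψ b / (1 + ψ b)) =
      (m * b).val * oddPart ψ b - 2 * (m * b).val * oddPart ψ (2 * b) +
        1 / 2 * (m * b).val := by
    intro b
    rcases eq_or_ne b 0 with rfl | hb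
    · simp
    · rw [div_one_add_addChar ψ hp2 hψ hb]
      ring
  have h3 : ∑ b : ZMod p, ((m * b).val : ℂ) * oddPart ψ b =
      ∑ b : ZMod p, ((2 * (m * b)).val : ℂ) * oddPart ψ (2 * b) := by
    rw [← sum_mul_left (two_ne_zero_zmod hp2)]
    exact Finset.sum_congr rfl fun b _ => by rw [mul_left_comm]
  rw [h1, Finset.sum_congr rfl fun b _ => h2 b, Finset.sum_add_distrib, Finset.sum_sub_distrib,
    h3, ← Finset.mul_sum, sum_mul_left hm fun b => (b.val : ℂ), ← Finset.sum_sub_distrib,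
    Finset.mul_sum (a := (p : ℂ)), add_comm, sub_eq_add_neg, ← Finset.sum_neg_distrib]
  congr 1
  refine Finset.sum_congr rfl fun b _ => ?_
  rw [val_two_mul hp2]
  ring

theorem weightedSum_sub (hp2 : p ≠ 2) (hψ : ∀ a, a ≠ 0 → ψ a ≠ 1) {m c : ZMod p}
    (hmc : m * c = 1) :
    weightedSum ψ 1 - weightedSum ψ c =
      2 * p * ∑ b : ZMod p with p < 2 * (-b).val ∧ p < 2 * (m * b).val, oddPart ψ (2 * b) := by
  have hm : m ≠ 0 := left_ne_zero_of_mul_eq_one hmc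
  let ind : ZMod p → ℂ := fun b => if p < 2 * b.val then 1 else 0
  have hind0 : ind 0 = 0 := by simp [ind]
  have hind : ∀ b, b ≠ 0 → ind (-b) = 1 - ind b := by
    intro b hb
    simp only [ind, lt_two_mul_val_neg hp2 hb]
    split_ifs <;> simp
  let h : ZMod p → ℂ := fun b => (ind (m * b) - ind b) * oddPart ψ (2 * b)
  have hodd : ∀ b, h (-b) = h b := by
    intro b
    rcases eq_or_ne b 0 with rfl | hb
    · simp
    · simp only [h, mul_neg, hind b hb, hind _ (mul_ne_zero hm hb),
        oddPart_neg ψ hψ (mul_ne_zero (two_ne_zero_zmod hp2) hb)]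
      ring
  have hsplit : ∑ b, h b = 2 * ∑ b, ind (-b) * h b := by
    have e1 : ∑ b, ind (-b) * h b = ∑ b, ind b * h b := by
      rw [← Equiv.sum_comp (Equiv.neg (ZMod p))]
      simp [hodd]
    have e2 : ∑ b, h b = ∑ b, (ind (-b) * h b + ind b * h b) := by
      refine Finset.sum_congr rfl fun b _ => ?_
      rcases eq_or_ne b 0 with rfl | hb
      · simp [h, hind0]
      · rw [hind b hb]
        ring
    rw [e2, Finset.sum_add_distrib, e1]
    ring
  have hfilter : ∑ b, ind (-b) * h b =
      ∑ b : ZMod p with p < 2 * (-b).val ∧ p < 2 * (m * b).val, oddPart ψ (2 * b) := by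
    rw [Finset.sum_filter]
    refine Finset.sum_congr rfl fun b _ => ?_
    rcases eq_or_ne b 0 with rfl | hb
    · simp [ind]
    · have := lt_two_mul_val_neg hp2 hb
      by_cases h1 : p < 2 * b.val <;> by_cases h2 : p < 2 * (m * b).val <;>
        simp [h, ind, this, h1, h2]
  rw [weightedSum_eq ψ hp2 hψ hmc, weightedSum_eq ψ hp2 hψ (one_mul (1 : ZMod p)), ← hfilter,
    mul_comm 2 (p : ℂ), mul_assoc, ← hsplit]
  simp only [h, ind, sub_mul, Finset.sum_sub_distrib, one_mul]
  ring

theorem prod_one_add_addChar (hp2 : p ≠ 2) (hψ : ∀ a, a ≠ 0 → ψ a ≠ 1) :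
    ∏ b : ZMod p, (1 + ψ b) = 2 := by
  have h2 := two_ne_zero_zmod hp2
  have h1 : ∏ b ∈ univ.erase (0 : ZMod p), (1 - ψ b) ≠ 0 :=
    Finset.prod_ne_zero_iff.2 fun b hb => sub_ne_zero.2 (hψ b (Finset.ne_of_mem_erase hb)).symm
  have h3 : ∏ b ∈ univ.erase (0 : ZMod p), (1 - ψ (2 * b)) =
      ∏ b ∈ univ.erase (0 : ZMod p), (1 - ψ b) :=
    Finset.prod_equiv (Equiv.mulLeft₀ 2 h2) (by simp [h2]) (by simp)
  have h4 : (∏ b ∈ univ.erase (0 : ZMod p), (1 + ψ b)) = 1 := by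
    refine mul_right_cancel₀ h1 ?_
    rw [one_mul, ← Finset.prod_mul_distrib]
    conv_rhs => rw [← h3]
    refine Finset.prod_congr rfl fun b _ => ?_
    rw [two_mul, AddChar.map_add_eq_mul]
    ring
  rw [← Finset.mul_prod_erase _ _ (Finset.mem_univ (0 : ZMod p)), h4]
  norm_num

end CharacterSums

theorem sum_zmod_eq_sum_range {p : ℕ} [NeZero p] {M : Type*} [AddCommMonoid M] (f : ZMod p → M) :
    ∑ b, f b = ∑ i ∈ range p, f i := by
  refine Finset.sum_nbij' ZMod.val (fun i => (i : ZMod p)) ?_ ?_ ?_ ?_ ?_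
  · exact fun b _ => by simpa using ZMod.val_lt b
  · simp
  · simp
  · exact fun i hi => ZMod.val_cast_of_lt (by simpa using hi)
  · simp

section FermatQuotient

variable {p : ℕ} [Fact p.Prime] {ζ : ℂ}

theorem weightedSum_zmodChar (hζ : IsPrimitiveRoot ζ p) (k : ℕ) :
    weightedSum (AddChar.zmodChar p hζ.pow_eq_one) k =
      ∑ i ∈ range p, (i : ℂ) * ((ζ ^ k) ^ i / (1 + (ζ ^ k) ^ i)) := by
  rw [weightedSum, sum_zmod_eq_sum_range]
  refine Finset.sum_congr rfl fun i hi => ?_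
  rw [ZMod.val_cast_of_lt (by simpa using hi), ← Nat.cast_mul, AddChar.zmodChar_apply', pow_mul]

theorem zmodChar_ne_one (hζ : IsPrimitiveRoot ζ p) (a : ZMod p) (ha : a ≠ 0) :
    AddChar.zmodChar p hζ.pow_eq_one a ≠ 1 := by
  rw [AddChar.zmodChar_apply]
  exact hζ.pow_ne_one_of_pos_of_lt (by simpa using ha) (ZMod.val_lt a)

theorem IsPrimitiveRoot.one_add_pow_ne_zero (hζ : IsPrimitiveRoot ζ p) (hp2 : p ≠ 2) (i : ℕ) :
    1 + ζ ^ i ≠ 0 := by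
  have := one_add_addChar_ne_zero _ hp2 (zmodChar_ne_one hζ) (i : ZMod p)
  rwa [AddChar.zmodChar_apply'] at this

theorem IsPrimitiveRoot.prod_one_add_pow_succ (hζ : IsPrimitiveRoot ζ p) (hp2 : p ≠ 2) :
    ∏ i ∈ range (p - 1), (1 + ζ ^ (i + 1)) = 1 := by
  have h := prod_one_add_addChar _ hp2 (zmodChar_ne_one hζ)
  have h' : ∏ b : ZMod p, (1 + AddChar.zmodChar p hζ.pow_eq_one b) =
      ∏ i ∈ range p, (1 + ζ ^ i) := by
    have := sum_zmod_eq_sum_range (p := p)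
      fun b => Additive.ofMul (1 + AddChar.zmodChar p hζ.pow_eq_one b)
    simpa only [← ofMul_prod, AddChar.zmodChar_apply', EmbeddingLike.apply_eq_iff_eq] using this
  rw [h', ← Nat.sub_add_cancel (Fact.out : p.Prime).one_le, Finset.prod_range_succ'] at h
  simp only [pow_zero] at h
  linear_combination h / 2

/-- The polynomial `q`-Fermat quotient to base two takes an explicit value at each primitive
`p`-th root of unity. -/
theorem exists_fermatQuotient_polynomial (hp2 : p ≠ 2) :
    ∃ A : ℚ[X], ∏ i ∈ range (p - 1), (1 + X ^ (i + 1)) - 1 = A * pqn X p ∧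
      ∀ η : ℂ, IsPrimitiveRoot η p →
        aeval η A = (η - 1) / p * ∑ i ∈ range p, (i : ℂ) * (η ^ i / (1 + η ^ i)) := by
  have hp : p.Prime := Fact.out
  have hroot := Complex.isPrimitiveRoot_exp p hp.ne_zero
  obtain ⟨A, hA⟩ : pqn X p ∣ ∏ i ∈ range (p - 1), (1 + X ^ (i + 1)) - (1 : ℚ[X]) := by
    rw [pqn_X_eq_minpoly hp hroot]
    apply minpoly.dvd
    simp only [map_sub, map_prod, map_add, map_one, map_pow, aeval_X]
    rw [hroot.prod_one_add_pow_succ hp2, sub_self]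
  rw [mul_comm] at hA
  refine ⟨A, hA, fun η hη => ?_⟩
  have hp0 : (p : ℂ) ≠ 0 := by exact_mod_cast hp.ne_zero
  have hη0 : η ≠ 0 := hη.ne_zero hp.ne_zero
  have hgeom : pqn (X : ℚ[X]) p * (X - 1) = X ^ p - 1 := geom_sum_mul _ _
  have hval : aeval η (pqn X p) = 0 := by rw [pqn_X_eq_minpoly hp hη, minpoly.aeval]
  have hder : aeval η (derivative (pqn X p)) * (η - 1) = p * η ^ (p - 1) := by
    have := congrArg (fun P => aeval η (derivative P)) hgeom
    simpa [hval, derivative_X_pow] using this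
  have hderA : aeval η (derivative (∏ i ∈ range (p - 1), (1 + X ^ (i + 1)) - (1 : ℚ[X]))) =
      aeval η A * aeval η (derivative (pqn X p)) := by
    rw [hA]
    simp [hval]
  have hprod : aeval η (derivative (∏ i ∈ range (p - 1), (1 + X ^ (i + 1)) - (1 : ℚ[X]))) =
      ∑ i ∈ range (p - 1), ((i + 1 : ℕ) : ℂ) * (η ^ i / (1 + η ^ (i + 1))) := by
    rw [derivative_sub, derivative_prod_finset, derivative_one, sub_zero, map_sum]
    refine Finset.sum_congr rfl fun i hi => ?_
    have h0 := hη.one_add_pow_ne_zero hp2 (i + 1)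
    have h1 := hη.prod_one_add_pow_succ hp2
    rw [← Finset.mul_prod_erase _ _ hi] at h1
    simp only [map_mul, map_prod, map_add, map_one, map_pow, aeval_X,
      derivative_one, derivative_X_pow, zero_add, map_natCast, Nat.add_sub_cancel]
    field_simp
    linear_combination h1
  have hshift : ∑ i ∈ range p, (i : ℂ) * (η ^ i / (1 + η ^ i)) =
      η * ∑ i ∈ range (p - 1), ((i + 1 : ℕ) : ℂ) * (η ^ i / (1 + η ^ (i + 1))) := by
    conv_lhs => rw [← Nat.sub_add_cancel hp.one_le, Finset.sum_range_succ']
    simp only [Nat.cast_zero, zero_mul, add_zero, Finset.mul_sum]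
    exact Finset.sum_congr rfl fun i _ => by rw [pow_succ]; ring
  have hηp : η * η ^ (p - 1) = 1 := by
    rw [← pow_succ', Nat.sub_add_cancel hp.one_le, hη.pow_eq_one]
  rw [hshift, ← hprod, hderA, div_mul_eq_mul_div, eq_div_iff hp0]
  linear_combination (-(aeval η A) * η) * hder - aeval η A * p * hηp

theorem q_pow_ne_one {n : ℕ} (hn : n ≠ 0) : q ^ n ≠ 1 := by
  intro h
  rw [q, ← map_pow, ← map_one (algebraMap ℚ[X] (RatFunc ℚ))] at h
  have := congrArg natDegree (RatFunc.algebraMap_injective ℚ h)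
  simp [hn] at this

theorem qpoch_sq_div {a : RatFunc ℚ} {n : ℕ} (ha : ∀ i < n, a ^ (i + 1) ≠ 1) :
    qpoch (a ^ 2) (a ^ 2) n / qpoch a a n = ∏ i ∈ range n, (1 + a ^ (i + 1)) := by
  rw [qpoch, qpoch, ← Finset.prod_div_distrib]
  refine Finset.prod_congr rfl fun i hi => ?_
  have h : 1 - a * a ^ i ≠ 0 := by
    rw [← pow_succ']
    exact sub_ne_zero.2 (ha i (by simpa using hi)).symm
  rw [div_eq_iff h]
  ring

theorem hasValue_QF (hp2 : p ≠ 2) (hζ : IsPrimitiveRoot ζ p) {k : ℕ} (hk : 0 < k)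
    (hpk : ¬ p ∣ k) :
    HasValue ζ (QF p 2 (q ^ k))
      ((ζ ^ k - 1) / p * weightedSum (AddChar.zmodChar p hζ.pow_eq_one) k) := by
  have hp : p.Prime := Fact.out
  obtain ⟨A, hA, hval⟩ := exists_fermatQuotient_polynomial hp2
  have hη : IsPrimitiveRoot (ζ ^ k) p :=
    hζ.pow_of_coprime k ((Nat.Prime.coprime_iff_not_dvd hp).2 hpk).symm
  have hne : qn (q ^ k) p ≠ 0 := by
    intro h
    have := geom_sum_mul (q ^ k) p
    rw [← qn, h, zero_mul, ← pow_mul] at this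
    exact q_pow_ne_one (mul_ne_zero hk.ne' hp.ne_zero) (sub_eq_zero.1 this.symm)
  have hQ : QF p 2 (q ^ k) = algebraMap ℚ[X] (RatFunc ℚ) (A.comp (X ^ k)) := by
    have hpoch := qpoch_sq_div (a := q ^ k) (n := p - 1) fun i _ => by
      rw [← pow_mul]
      exact q_pow_ne_one (mul_ne_zero hk.ne' i.succ_ne_zero)
    rw [QF, hpoch, div_eq_iff hne]
    have := congrArg (fun P => algebraMap ℚ[X] (RatFunc ℚ) (P.comp (X ^ k))) hA
    simpa [Polynomial.prod_comp, pqn, qn, q] using this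
  rw [hQ, weightedSum_zmodChar hζ, ← hval _ hη]
  simpa [aeval_comp] using HasValue.ofPolynomial (ζ := ζ) (A.comp (X ^ k))

end FermatQuotient

theorem sum_Rset_eq {p : ℕ} [Fact p.Prime] (hp2 : p ≠ 2) (m : ℤ) (f : ZMod p → ℂ) :
    ∑ j ∈ Rset p m, f j =
      ∑ b : ZMod p with p < 2 * (-b).val ∧ p < 2 * ((m : ZMod p) * b).val, f b := by
  have hp : p.Prime := Fact.out
  have hodd := hp.eq_two_or_odd.resolve_left hp2
  have hres : ∀ x : ℤ, res p x = (x : ZMod p).val := fun x => by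
    rw [res, ← ZMod.val_intCast, Int.toNat_natCast]
  refine Finset.sum_nbij' (fun j => (j : ZMod p)) ZMod.val ?_ ?_ ?_ ?_ ?_
  · intro j hj
    simp only [Rset, hres, Finset.mem_filter, Finset.mem_Icc] at hj
    obtain ⟨⟨h1, h2⟩, h3⟩ := hj
    have hval : (j : ZMod p).val = j := ZMod.val_cast_of_lt (by omega)
    have hj0 : (j : ZMod p) ≠ 0 := fun h => by simp [h] at hval; omega
    have hneg := lt_two_mul_val_neg hp2 hj0
    rw [hval] at hneg
    push_cast at h3
    simp only [Finset.mem_filter, Finset.mem_univ, true_and]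
    exact ⟨hneg.2 (by omega), by rwa [mul_comm (m : ZMod p)]⟩
  · intro b hb
    simp only [Finset.mem_filter, Finset.mem_univ, true_and] at hb
    have hb0 : b ≠ 0 := by rintro rfl; simp at hb
    have hlt := (lt_two_mul_val_neg hp2 hb0).1 hb.1
    have hpos : b.val ≠ 0 := by simpa using hb0
    simp only [Rset, hres, Finset.mem_filter, Finset.mem_Icc]
    refine ⟨by omega, ?_⟩
    push_cast
    rw [ZMod.natCast_zmod_val, mul_comm b]
    exact hb.2
  · intro j hj
    simp only [Rset, Finset.mem_filter, Finset.mem_Icc] at hj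
    exact ZMod.val_cast_of_lt (by omega)
  · simp
  · simp

theorem sum_Rset_inv_congruence (p : ℕ) (hp : p.Prime) (hp5 : 5 ≤ p)
    (m : ℤ) (hpm : ¬ (p : ℤ) ∣ m) (m' : ℕ) (hm' : 0 < m')
    (hinv : (m' : ℤ) * m ≡ 1 [ZMOD (p : ℤ)]) :
    qCong (pqn Polynomial.X p)
      (∑ j ∈ Rset p m, 1 / qn (q ^ 2) j)
      (((Rset p m).card : RatFunc ℚ) / 2 * (1 - q ^ 2) +
        (1 + q ^ m') * QF p 2 (q ^ m') / (2 * qn (q ^ 2) m') -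
        (1 + q) / 2 * QF p 2 q) := by
  have := Fact.mk hp
  have hp2 : p ≠ 2 := by omega
  have hp0 : (p : ℂ) ≠ 0 := by exact_mod_cast hp.ne_zero
  have hζ := Complex.isPrimitiveRoot_exp p hp.ne_zero
  set ζ : ℂ := Complex.exp (2 * Real.pi * Complex.I / p)
  set ψ := AddChar.zmodChar p hζ.pow_eq_one with hψ_def
  have hmc : (m : ZMod p) * (m' : ZMod p) = 1 := by
    have := (ZMod.intCast_eq_intCast_iff _ _ _).2 hinv
    push_cast at this
    rwa [mul_comm]
  have hpm' : ¬ p ∣ m' := by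
    rw [← ZMod.natCast_eq_zero_iff]
    exact right_ne_zero_of_mul_eq_one hmc
  have hne : ∀ k : ℕ, ¬ p ∣ k → ζ ^ k ≠ 1 := fun k hk h => hk (hζ.dvd_of_pow_eq_one k h)
  have hsq : ζ ^ 2 ≠ 1 := hne 2 fun h => by have := Nat.le_of_dvd two_pos h; omega
  have hgeom : ∀ k : ℕ, ¬ p ∣ k →
      ∑ i ∈ range k, (ζ ^ 2) ^ i = (1 - (ζ ^ k) ^ 2) / (1 - ζ ^ 2) ∧ 1 - (ζ ^ k) ^ 2 ≠ 0 := by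
    intro k hk
    refine ⟨?_, ?_⟩
    · rw [geom_sum_eq hsq, ← neg_div_neg_eq, neg_sub, neg_sub, ← pow_mul, ← pow_mul, mul_comm]
    · rw [← pow_mul]
      refine sub_ne_zero.2 (hne _ fun h => ?_).symm
      rcases hp.dvd_mul.1 h with h | h
      · exact hk h
      · have := Nat.le_of_dvd two_pos h
        omega
  have hsq' : 1 - ζ ^ 2 ≠ 0 := sub_ne_zero.2 hsq.symm
  have hndvd : ∀ j ∈ Rset p m, ¬ p ∣ j := by
    intro j hj hdvd
    simp only [Rset, Finset.mem_filter, Finset.mem_Icc] at hj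
    have := Nat.le_of_dvd (by omega) hdvd
    omega
  have hQ1 := hasValue_QF hp2 hζ one_pos (by simpa using hp.ne_one)
  have hQm := hasValue_QF hp2 hζ hm' hpm'
  simp only [pow_one, Nat.cast_one] at hQ1
  have hq := HasValue.q (ζ := ζ)
  have hone := HasValue.one (ζ := ζ)
  have htwo := HasValue.two (ζ := ζ)
  obtain ⟨hgm, hgm0⟩ := hgeom m' hpm'
  have hL : HasValue ζ (∑ j ∈ Rset p m, 1 / qn (q ^ 2) j)
      (∑ j ∈ Rset p m, 1 / ∑ i ∈ range j, (ζ ^ 2) ^ i) := by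
    refine HasValue.sum _ fun j hj => hone.div ((hq.pow 2).qn j) ?_
    obtain ⟨h1, h2⟩ := hgeom j (hndvd j hj)
    rw [h1]
    exact div_ne_zero h2 hsq'
  refine qCong_of_hasValue hp hζ hL
    (((((HasValue.natCast _).div htwo two_ne_zero).mul (hone.sub (hq.pow 2))).add
      (((hone.add (hq.pow m')).mul hQm).div (htwo.mul ((hq.pow 2).qn m')) ?_)).sub
      (((hone.add hq).div htwo two_ne_zero).mul hQ1)) ?_
  · rw [hgm]
    exact mul_ne_zero two_ne_zero (div_ne_zero hgm0 hsq')
  have hsum : ∑ j ∈ Rset p m, 1 / ∑ i ∈ range j, (ζ ^ 2) ^ i =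
      (1 - ζ ^ 2) * (∑ j ∈ Rset p m, oddPart ψ (2 * (j : ZMod p))) +
        (Rset p m).card / 2 * (1 - ζ ^ 2) := by
    have hcard : ((Rset p m).card : ℂ) / 2 * (1 - ζ ^ 2) =
        ∑ j ∈ Rset p m, 1 / 2 * (1 - ζ ^ 2) := by
      rw [Finset.sum_const, nsmul_eq_mul]
      ring
    rw [hcard, Finset.mul_sum, ← Finset.sum_add_distrib]
    refine Finset.sum_congr rfl fun j hj => ?_
    have hψj : ψ (2 * (j : ZMod p)) = (ζ ^ j) ^ 2 := by
      rw [two_mul, AddChar.map_add_eq_mul, AddChar.zmodChar_apply']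
      ring
    rw [(hgeom j (hndvd j hj)).1, oddPart, hψj, one_div_div]
    ring
  have hdiff := weightedSum_sub ψ hp2 (zmodChar_ne_one hζ) hmc
  rw [← sum_Rset_eq hp2 m fun b => oddPart ψ (2 * b)] at hdiff
  have hfac : 1 - (ζ ^ m') ^ 2 = (1 - ζ ^ m') * (1 + ζ ^ m') := by ring
  rw [hfac] at hgm hgm0
  have h1 := left_ne_zero_of_mul hgm0
  have h2 := right_ne_zero_of_mul hgm0
  have hmid : (1 + ζ ^ m') * ((ζ ^ m' - 1) / p * weightedSum ψ m') /
      (2 * ((1 - ζ ^ m') * (1 + ζ ^ m') / (1 - ζ ^ 2))) =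
      -(1 - ζ ^ 2) / (2 * p) * weightedSum ψ m' := by
    field_simp
    ring
  have hfirst : ∑ j ∈ Rset p m, oddPart ψ (2 * (j : ZMod p)) =
      (weightedSum ψ 1 - weightedSum ψ m') / (2 * p) := by
    rw [hdiff]
    field_simp
  rw [hsum, hgm, hmid, hfirst]
  field_simp
  ring
end

section
/- Let p ≥ 5 be a prime and m ≥ 2 an integer with p ∤ m. Then, as a congruence between integers modulo p^2, (−1)^{((p−1)/2)·⌊m/2⌋} (m/p) (2/p)^{m−1} ∏_{k=1}^{⌊m/2⌋} C(p−1, ⌊pk/m⌋) ≡ 1 + (m/p)·eq_p(m)·m·p + (2⌊m/2⌋ + 1 − m)·q_p(2)·p (mod p^2), where C(a,b) denotes the ordinary binomial coefficient. -/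
open Polynomial Finset

theorem exists_prod_add_mul_eq (p : ℕ) [Fact p.Prime] {ι : Type*} (s : Finset ι) (u a : ι → ℤ)
    (hu : ∀ i ∈ s, (u i : ZMod p) ≠ 0) :
    ∃ t : ℤ, ∏ i ∈ s, (u i + p * a i) = ∏ i ∈ s, u i + p * t ∧
      (t : ZMod p) = (∏ i ∈ s, (u i : ZMod p)) * ∑ i ∈ s, (a i : ZMod p) * (u i : ZMod p)⁻¹ := by
  classical
  induction s using Finset.induction_on with
  | empty => exact ⟨0, by simp⟩
  | insert i s hi ih =>
    obtain ⟨t, ht, ht'⟩ := ih fun j hj => hu j (mem_insert_of_mem hj)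
    refine ⟨u i * t + a i * ∏ j ∈ s, u j + p * (a i * t), ?_, ?_⟩
    · rw [prod_insert hi, prod_insert hi, ht]
      ring
    · have h0 := hu i (mem_insert_self i s)
      rw [prod_insert hi, sum_insert hi]
      push_cast
      rw [ht', CharP.cast_eq_zero]
      field_simp
      ring

theorem natCast_zmod_ne_zero {p j : ℕ} (hj : 0 < j) (hjp : j < p) : (j : ZMod p) ≠ 0 := by
  rw [Ne, ZMod.natCast_eq_zero_iff]
  exact Nat.not_dvd_of_pos_of_lt hj hjp

/-- `C(p - 1, r) ≡ (-1) ^ r * (1 - p * H_r)` modulo `p ^ 2`, where `H_r` is a harmonic number. -/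
theorem exists_choose_pred_prime_eq (p : ℕ) [hp : Fact p.Prime] (r : ℕ) (hr : r < p) :
    ∃ h : ℤ, ((p - 1).choose r : ℤ) = (-1) ^ r * (1 + p * h) ∧
      (h : ZMod p) = -∑ j ∈ Ico 1 (r + 1), (j : ZMod p)⁻¹ := by
  induction r with
  | zero => exact ⟨0, by simp⟩
  | succ r ih =>
    obtain ⟨h, hc, hh⟩ := ih (by omega)
    have hp1 : p - 1 + 1 = p := Nat.sub_add_cancel hp.out.one_le
    obtain ⟨c, hpc⟩ := hp.out.dvd_choose_self (Nat.succ_ne_zero r) hr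
    have hpascal : ((p - 1).choose r : ℤ) + (p - 1).choose (r + 1) = p * c := by
      have := Nat.choose_succ_succ' (p - 1) r
      rw [hp1] at this
      exact_mod_cast this.symm.trans hpc
    have hmul : (c : ℤ) * (r + 1) = (p - 1).choose r := by
      have := Nat.add_one_mul_choose_eq (p - 1) r
      rw [hp1, hpc, mul_assoc] at this
      exact_mod_cast (Nat.eq_of_mul_eq_mul_left hp.out.pos this).symm
    have hsq : ((-1 : ℤ) ^ r) * (-1) ^ r = 1 := by rw [← mul_pow]; simp
    refine ⟨h - (-1) ^ r * c, ?_, ?_⟩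
    · rw [pow_succ]
      linear_combination hpascal - hc - p * c * hsq
    · have hr0 : ((r + 1 : ℕ) : ZMod p) ≠ 0 := natCast_zmod_ne_zero r.succ_pos hr
      have hcz : (c : ZMod p) * (r + 1 : ℕ) = (-1) ^ r := by
        have := congrArg (Int.cast : ℤ → ZMod p) (hmul.trans hc)
        push_cast at this ⊢
        rw [this, CharP.cast_eq_zero]
        ring
      have hsq' : ((-1 : ZMod p) ^ r) * (-1) ^ r = 1 := by rw [← mul_pow]; simp
      rw [sum_Ico_succ_top (by omega), neg_add, ← hh]
      push_cast at hcz hr0 ⊢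
      field_simp
      linear_combination (-(-1) ^ r) * hcz - hsq'

theorem image_mul_mod_Ico (p : ℕ) [hp : Fact p.Prime] {m : ℕ} (hpm : ¬ p ∣ m) :
    Set.InjOn (fun j => j * m % p) (Ico 1 p) ∧ (Ico 1 p).image (fun j => j * m % p) = Ico 1 p := by
  have hinj : Set.InjOn (fun j => j * m % p) (Ico 1 p) := by
    intro i hi j hj hij
    simp only [coe_Ico, Set.mem_Ico] at hi hj
    have hcop : Nat.gcd p m = 1 := (hp.out.coprime_iff_not_dvd).2 hpm
    have hmod : i ≡ j [MOD p] := Nat.ModEq.cancel_right_of_coprime hcop hij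
    exact hmod.eq_of_lt_of_lt hi.2 hj.2
  refine ⟨hinj, eq_of_subset_of_card_le ?_ (card_image_of_injOn hinj).ge⟩
  intro i hi
  obtain ⟨j, hj, rfl⟩ := mem_image.1 hi
  rw [mem_Ico] at hj ⊢
  refine ⟨Nat.pos_of_ne_zero fun h => ?_, Nat.mod_lt _ hp.out.pos⟩
  rcases (hp.out.dvd_mul).1 (Nat.dvd_of_mod_eq_zero h) with h | h
  · exact Nat.not_dvd_of_pos_of_lt hj.1 hj.2 h
  · exact hpm h

/-- Lerch's formula for the Fermat quotient. -/
theorem mul_fermat_quotient_eq_sum (p : ℕ) [hp : Fact p.Prime] {m : ℕ} (hpm : ¬ p ∣ m) {q : ℤ}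
    (hq : (m : ℤ) ^ (p - 1) = 1 + p * q) :
    (m : ZMod p) * q = ∑ j ∈ Ico 1 p, ((j * m / p : ℕ) : ZMod p) * (j : ZMod p)⁻¹ := by
  obtain ⟨hinj, himage⟩ := image_mul_mod_Ico p hpm
  have hm0 : (m : ZMod p) ≠ 0 := by rwa [Ne, ZMod.natCast_eq_zero_iff]
  have hj0 : ∀ j ∈ Ico 1 p, (j : ZMod p) ≠ 0 := fun j hj =>
    natCast_zmod_ne_zero (mem_Ico.1 hj).1 (mem_Ico.1 hj).2
  have hcast : ∀ j : ℕ, ((j * m % p : ℕ) : ZMod p) = j * m := fun j => by simp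
  obtain ⟨t, ht, ht'⟩ := exists_prod_add_mul_eq p (Ico 1 p) (fun j => ((j * m % p : ℕ) : ℤ))
    (fun j => ((j * m / p : ℕ) : ℤ)) fun j hj => by
      rw [Int.cast_natCast, hcast]
      exact mul_ne_zero (hj0 j hj) hm0
  have hdiv : ∀ j : ℕ, ((j * m % p : ℕ) : ℤ) + p * ((j * m / p : ℕ) : ℤ) = j * m := fun j => by
    exact_mod_cast Nat.mod_add_div (j * m) p
  have hperm : ∏ j ∈ Ico 1 p, ((j * m % p : ℕ) : ℤ) = ∏ j ∈ Ico 1 p, (j : ℤ) := by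
    rw [← prod_image (f := fun i : ℕ => (i : ℤ)) hinj, himage]
  have hpermz : ∏ j ∈ Ico 1 p, ((j * m % p : ℕ) : ZMod p) = ∏ j ∈ Ico 1 p, (j : ZMod p) := by
    have := congrArg (Int.cast : ℤ → ZMod p) hperm
    simpa only [Int.cast_prod, Int.cast_natCast] using this
  simp only [hdiv, hperm, prod_mul_distrib, prod_const, Nat.card_Ico, hq] at ht
  simp only [Int.cast_natCast, hpermz] at ht'
  have hp0 : (p : ℤ) ≠ 0 := by exact_mod_cast hp.out.ne_zero
  have htq : t = (∏ j ∈ Ico 1 p, (j : ℤ)) * q := by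
    apply mul_left_cancel₀ hp0
    linear_combination -ht
  rw [htq] at ht'
  push_cast at ht'
  rw [mul_left_cancel₀ (prod_ne_zero_iff.2 hj0) ht', mul_sum]
  refine sum_congr rfl fun j hj => ?_
  have := hj0 j hj
  rw [hcast]
  field_simp

theorem sum_Ico_eq_sum_half_add_reflect {M : Type*} [AddCommMonoid M] {p : ℕ} (hp : Odd p)
    (g : ℕ → M) :
    ∑ j ∈ Ico 1 p, g j = ∑ j ∈ Ico 1 (p / 2 + 1), (g j + g (p - j)) := by
  obtain ⟨n, rfl⟩ := hp
  have hn : (2 * n + 1) / 2 = n := by omega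
  have hreflect := sum_Ico_reflect g 1 (m := n + 1) (n := 2 * n + 1) (by omega)
  rw [hn, sum_add_distrib, hreflect,
    show 2 * n + 1 + 1 - (n + 1) = n + 1 by omega, show 2 * n + 1 + 1 - 1 = 2 * n + 1 by omega]
  rcases Nat.eq_zero_or_pos n with rfl | h
  · simp
  · exact (sum_Ico_consecutive g (by omega) (by omega)).symm

theorem reflect_mul_div (p : ℕ) [hp : Fact p.Prime] {m j : ℕ} (hpm : ¬ p ∣ m) (hj : 0 < j)
    (hjp : j < p) : (p - j) * m / p + j * m / p + 1 = m := by
  have hndvd : ¬ p ∣ j * m := fun h => by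
    rcases (hp.out.dvd_mul).1 h with h | h
    · exact Nat.not_dvd_of_pos_of_lt hj hjp h
    · exact hpm h
  have hmod : 0 < j * m % p := Nat.pos_of_ne_zero fun h => hndvd (Nat.dvd_of_mod_eq_zero h)
  have hmod' : j * m % p < p := Nat.mod_lt _ hp.out.pos
  have hle : j * m / p < m := by
    rw [Nat.div_lt_iff_lt_mul hp.out.pos, mul_comm m]
    exact Nat.mul_lt_mul_of_pos_right hjp (Nat.pos_of_ne_zero fun h => hpm (h ▸ dvd_zero p))
  have hda := Nat.mod_add_div (j * m) p
  obtain ⟨d, hd⟩ := Nat.exists_eq_add_of_lt hle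
  have hmain : (p - j) * m = (p - j * m % p) + p * d := by
    zify [hjp.le, hmod'.le] at hda hd ⊢
    linear_combination p * hd + hda
  rw [hmain, Nat.add_mul_div_left _ _ hp.out.pos, Nat.div_eq_of_lt (by omega)]
  omega

theorem mul_fermat_quotient_eq_half_sum (p : ℕ) [hp : Fact p.Prime] (hp2 : p ≠ 2) {m : ℕ}
    (hpm : ¬ p ∣ m) {q : ℤ} (hq : (m : ℤ) ^ (p - 1) = 1 + p * q) :
    (m : ZMod p) * q =
      2 * ∑ j ∈ Ico 1 (p / 2 + 1), ((j * m / p : ℕ) : ZMod p) * (j : ZMod p)⁻¹ -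
        (m - 1) * ∑ j ∈ Ico 1 (p / 2 + 1), (j : ZMod p)⁻¹ := by
  rw [mul_fermat_quotient_eq_sum p hpm hq,
    sum_Ico_eq_sum_half_add_reflect (hp.out.odd_of_ne_two hp2), mul_sum, mul_sum,
    ← sum_sub_distrib]
  refine sum_congr rfl fun j hj => ?_
  have hj' := mem_Ico.1 hj
  have hjp : j < p := by omega
  have h := congrArg (Nat.cast : ℕ → ZMod p) (reflect_mul_div p hpm hj'.1 hjp)
  push_cast at h
  rw [Nat.cast_sub hjp.le, CharP.cast_eq_zero (ZMod p) p, zero_sub, inv_neg]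
  linear_combination (-(j : ZMod p)⁻¹) * h

theorem half_harmonic_eq (p : ℕ) [hp : Fact p.Prime] (hp2 : p ≠ 2) {f : ℤ}
    (hf : (2 : ℤ) ^ (p - 1) = 1 + p * f) :
    ∑ j ∈ Ico 1 (p / 2 + 1), (j : ZMod p)⁻¹ = -(2 * f) := by
  have h2 : ¬ p ∣ 2 := fun h => hp2 ((Nat.prime_dvd_prime_iff_eq hp.out Nat.prime_two).1 h)
  have h := mul_fermat_quotient_eq_half_sum p hp2 h2 (q := f) (by exact_mod_cast hf)
  have h0 : ∑ j ∈ Ico 1 (p / 2 + 1), ((j * 2 / p : ℕ) : ZMod p) * (j : ZMod p)⁻¹ = 0 := by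
    refine sum_eq_zero fun j hj => ?_
    have hodd := Nat.odd_iff.1 (hp.out.odd_of_ne_two hp2)
    have hj' := mem_Ico.1 hj
    rw [Nat.div_eq_of_lt (by omega), Nat.cast_zero, zero_mul]
  rw [h0] at h
  push_cast at h
  linear_combination h

theorem sum_harmonic_swap (p : ℕ) [hp : Fact p.Prime] {m : ℕ} (hpm : ¬ p ∣ m) {M : Type*}
    [AddCommMonoid M] (g : ℕ → M) :
    ∑ k ∈ Icc 1 (m / 2), ∑ j ∈ Ico 1 (p * k / m + 1), g j =
      ∑ j ∈ Ico 1 (p / 2 + 1), (m / 2 - j * m / p) • g j := by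
  have hm0 : 0 < m := Nat.pos_of_ne_zero fun h => hpm (h ▸ dvd_zero p)
  rw [sum_comm' (t' := Ico 1 (p / 2 + 1)) (s' := fun j => Ioc (j * m / p) (m / 2))]
  · simp
  intro k j
  simp only [mem_Icc, mem_Ico, mem_Ioc, Nat.lt_succ_iff]
  rw [Nat.le_div_iff_mul_le hm0, Nat.div_lt_iff_lt_mul hp.out.pos, mul_comm p k,
    Nat.le_div_iff_mul_le two_pos, Nat.le_div_iff_mul_le two_pos]
  constructor
  · rintro ⟨⟨hk, hkm⟩, hj, hjk⟩
    have hjp : j * 2 ≤ p := by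
      refine Nat.le_of_mul_le_mul_right (?_ : j * 2 * m ≤ p * m) hm0
      nlinarith
    refine ⟨⟨lt_of_le_of_ne hjk fun h => ?_, hkm⟩, hj, hjp⟩
    have hlt : j < p := by omega
    rcases (hp.out.dvd_mul).1 (Dvd.intro_left k h.symm) with h | h
    · exact Nat.not_dvd_of_pos_of_lt hj hlt h
    · exact hpm h
  · rintro ⟨⟨hjk, hkm⟩, hj, hjp⟩
    refine ⟨⟨Nat.pos_of_ne_zero fun h => ?_, hkm⟩, hj, hjk.le⟩
    simp [h] at hjk

theorem legendreSym_mul_legendreSym_two_pow (p : ℕ) [hp : Fact p.Prime] (hp2 : p ≠ 2) {m : ℕ}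
    (hm : 0 < m) (hpm : ¬ p ∣ m) :
    legendreSym p m * legendreSym p 2 ^ (m - 1) =
      (-1) ^ ∑ j ∈ Ico 1 (p / 2).succ, j * m / p := by
  have hodd := Nat.odd_iff.1 (hp.out.odd_of_ne_two hp2)
  have h2 : (2 : ZMod p) ≠ 0 := by
    have := natCast_zmod_ne_zero two_pos (lt_of_le_of_ne hp.out.two_le hp2.symm)
    exact_mod_cast this
  have hsq : legendreSym p 2 ^ 2 = 1 := legendreSym.sq_one p (by exact_mod_cast h2)
  have heven : ∀ a : ℕ, a % 2 = 0 → ¬ p ∣ a → legendreSym p a =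
      (-1) ^ (∑ j ∈ Ico 1 (p / 2).succ, j * a / p) * (-1) ^ ∑ j ∈ Ico 1 (p / 2).succ, j := by
    intro a ha hpa
    have hshift : legendreSym p a = legendreSym p (a + p : ℕ) := by
      rw [legendreSym.mod p (a + p : ℕ), legendreSym.mod p a]
      simp
    rw [hshift, ZMod.eisenstein_lemma hp2 (by omega), ← pow_add, ← sum_add_distrib]
    · congr 1
      refine sum_congr rfl fun j _ => ?_
      rw [mul_add, Nat.add_mul_div_right _ _ hp.out.pos]
    · simpa [ZMod.natCast_eq_zero_iff] using hpa
  have htwo : legendreSym p 2 = (-1) ^ ∑ j ∈ Ico 1 (p / 2).succ, j := by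
    have h := heven 2 rfl (by rw [← ZMod.natCast_eq_zero_iff]; exact_mod_cast h2)
    rw [sum_eq_zero (f := fun j => j * 2 / p), pow_zero, one_mul] at h
    · exact_mod_cast h
    · intro j hj
      have hj' := mem_Ico.1 hj
      exact Nat.div_eq_of_lt (by omega)
  rcases Nat.even_or_odd m with ⟨n, hn⟩ | ⟨n, hn⟩
  · rw [show m - 1 = 2 * (n - 1) + 1 by omega, pow_succ, pow_mul, hsq, one_pow, one_mul,
      heven m (by omega) hpm, ← htwo, mul_assoc, ← sq, hsq, mul_one]
  · rw [show m - 1 = 2 * n by omega, pow_mul, hsq, one_pow, mul_one,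
      ZMod.eisenstein_lemma hp2 (by omega) (by rwa [Ne, ZMod.natCast_eq_zero_iff])]

theorem sun_product_binomial_congruence (p : ℕ) [Fact p.Prime] (hp5 : 5 ≤ p)
    (m : ℕ) (hm : 2 ≤ m) (hpm : ¬ p ∣ m) (e f : ℤ)
    (he : (m : ℤ) ^ ((p - 1) / 2) = legendreSym p m + p * e)
    (hf : (2 : ℤ) ^ (p - 1) = 1 + p * f) :
    (-1 : ℤ) ^ (((p - 1) / 2) * (m / 2)) * legendreSym p m *
        legendreSym p 2 ^ (m - 1) *
        ∏ k ∈ Finset.Icc 1 (m / 2), ((p - 1).choose (p * k / m) : ℤ) ≡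
      1 + legendreSym p m * e * m * p +
        (2 * ((m / 2 : ℕ) : ℤ) + 1 - m) * f * p [ZMOD ((p : ℤ) ^ 2)] := by
  have hp := Fact.out (p := p.Prime)
  have hp2 : p ≠ 2 := by omega
  have hodd := Nat.odd_iff.1 (hp.odd_of_ne_two hp2)
  have hmz : ((m : ℤ) : ZMod p) ≠ 0 := by
    rwa [Int.cast_natCast, Ne, ZMod.natCast_eq_zero_iff]
  set L := legendreSym p m with hL
  have hLsq : L ^ 2 = 1 := legendreSym.sq_one p hmz
  have hq : (m : ℤ) ^ (p - 1) = 1 + p * (2 * L * e + p * e ^ 2) := by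
    rw [show p - 1 = (p - 1) / 2 * 2 by omega, pow_mul, he]
    linear_combination hLsq
  choose! h hchoose hharm using exists_choose_pred_prime_eq p
  have hlt : ∀ k ∈ Icc 1 (m / 2), p * k / m < p := fun k hk => by
    have := mem_Icc.1 hk
    rw [Nat.div_lt_iff_lt_mul (by omega)]
    exact Nat.mul_lt_mul_of_pos_left (by omega) hp.pos
  obtain ⟨t, ht, ht'⟩ := exists_prod_add_mul_eq p (Icc 1 (m / 2)) (fun _ => 1)
    (fun k => h (p * k / m)) (by simp)
  have hprod : ∏ k ∈ Icc 1 (m / 2), ((p - 1).choose (p * k / m) : ℤ) =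
      (-1) ^ (∑ k ∈ Icc 1 (m / 2), p * k / m) * (1 + p * t) := by
    rw [prod_congr rfl fun k hk => hchoose _ (hlt k hk), prod_mul_distrib, ht, prod_pow_eq_pow_sum]
    simp
  have hsign : (-1 : ℤ) ^ (((p - 1) / 2) * (m / 2)) * L * legendreSym p 2 ^ (m - 1) *
      (-1) ^ (∑ k ∈ Icc 1 (m / 2), p * k / m) = 1 := by
    have hrec := ZMod.sum_mul_div_add_sum_mul_div_eq_mul p m (by simpa using hmz)
    have hIcc : ∑ k ∈ Ico 1 (m / 2).succ, k * p / m = ∑ k ∈ Icc 1 (m / 2), p * k / m := by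
      simp only [mul_comm p]
      rfl
    rw [mul_assoc _ L, legendreSym_mul_legendreSym_two_pow p hp2 (by omega) hpm,
      show (p - 1) / 2 = p / 2 by omega, ← hrec, hIcc, mul_assoc, ← pow_add, ← mul_pow]
    simp
  have htz : (t : ZMod p) = ((L * e * m + (2 * ((m / 2 : ℕ) : ℤ) + 1 - m) * f : ℤ) : ZMod p) := by
    have h2 : (2 : ZMod p) ≠ 0 := by
      have := natCast_zmod_ne_zero (p := p) two_pos (by omega)
      exact_mod_cast this
    have hlerch := mul_fermat_quotient_eq_half_sum p hp2 hpm hq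
    have hhalf := half_harmonic_eq p hp2 hf
    have hsum : (t : ZMod p) =
        -∑ j ∈ Ico 1 (p / 2 + 1), (m / 2 - j * m / p) • (j : ZMod p)⁻¹ := by
      rw [ht', ← sum_harmonic_swap p hpm, ← sum_neg_distrib]
      simp only [Int.cast_one, prod_const_one, one_mul, inv_one, mul_one]
      exact sum_congr rfl fun k hk => hharm _ (hlt k hk)
    have hsplit : ∑ j ∈ Ico 1 (p / 2 + 1), (m / 2 - j * m / p) • (j : ZMod p)⁻¹ =
        (m / 2 : ℕ) * ∑ j ∈ Ico 1 (p / 2 + 1), (j : ZMod p)⁻¹ -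
          ∑ j ∈ Ico 1 (p / 2 + 1), ((j * m / p : ℕ) : ZMod p) * (j : ZMod p)⁻¹ := by
      rw [mul_sum, ← sum_sub_distrib]
      refine sum_congr rfl fun j hj => ?_
      have hj' := mem_Ico.1 hj
      have hle : j * m / p ≤ m / 2 := by
        rw [Nat.le_div_iff_mul_le two_pos]
        refine Nat.le_of_mul_le_mul_right (?_ : j * m / p * 2 * p ≤ m * p) hp.pos
        have h1 := Nat.div_mul_le_self (j * m) p
        have h2 : j * 2 ≤ p := by omega
        nlinarith
      rw [nsmul_eq_mul, Nat.cast_sub hle, sub_mul]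
    rw [hsplit] at hsum
    rw [hhalf] at hlerch hsum
    apply mul_left_cancel₀ h2
    generalize m / 2 = n at hsum ⊢
    push_cast [CharP.cast_eq_zero] at hlerch hsum ⊢
    linear_combination 2 * hsum - hlerch
  have hdvd : (p : ℤ) ∣ (L * e * m + (2 * ((m / 2 : ℕ) : ℤ) + 1 - m) * f) - t :=
    (ZMod.intCast_eq_intCast_iff_dvd_sub _ _ _).1 htz
  obtain ⟨c, hc⟩ := hdvd
  rw [hprod, Int.modEq_iff_dvd]
  refine ⟨c, ?_⟩
  linear_combination p * hc - (1 + p * t) * hsign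
end

section
/- Let p ≥ 1 and n be integers with 0 ≤ n ≤ p−1, and let Q be an indeterminate. Then, in the field ℚ(Q), [p−1 choose n]_Q = (−1)^n · Q^{−n(n+1)/2} · ∏_{j=1}^{n} (1 − [p]_Q/[j]_Q). -/
open Polynomial Finset

theorem q_ne_zero : q ≠ 0 := RatFunc.X_ne_zero

theorem one_sub_q_pow_ne_zero {n : ℕ} (hn : n ≠ 0) : 1 - q ^ n ≠ 0 := by
  intro h
  have h' : (X : Polynomial ℚ) ^ n = 1 := by
    apply RatFunc.algebraMap_injective ℚ
    simpa [q] using (sub_eq_zero.mp h).symm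
  simpa [hn] using congrArg (Polynomial.eval 0) h'

theorem qpoch_q_succ (n : ℕ) : qpoch q q (n + 1) = qpoch q q n * (1 - q ^ (n + 1)) := by
  rw [qpoch, prod_range_succ, ← qpoch, pow_succ']

theorem qpoch_q_ne_zero (n : ℕ) : qpoch q q n ≠ 0 := by
  refine prod_ne_zero_iff.mpr fun i _ => ?_
  rw [← pow_succ']
  exact one_sub_q_pow_ne_zero i.succ_ne_zero

theorem qn_mul_one_sub (n : ℕ) : qn q n * (1 - q) = 1 - q ^ n :=
  geom_sum_mul_neg q n

theorem one_sub_qn_div_qn (k : ℕ) {j : ℕ} (hj : j ≠ 0) :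
    1 - qn q (j + k) / qn q j = -(q ^ j * ((1 - q ^ k) / (1 - q ^ j))) := by
  have h1 : 1 - q ≠ 0 := by simpa using one_sub_q_pow_ne_zero one_ne_zero
  have hj' := one_sub_q_pow_ne_zero hj
  rw [← mul_div_mul_right _ _ h1, qn_mul_one_sub, qn_mul_one_sub, pow_add]
  field_simp
  ring

theorem qbinom_succ_right (n k : ℕ) :
    qbinom q (n + 1 + k) (n + 1) =
      qbinom q (n + 1 + k) n * ((1 - q ^ (k + 1)) / (1 - q ^ (n + 1))) := by
  have hn := one_sub_q_pow_ne_zero n.succ_ne_zero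
  have hk := one_sub_q_pow_ne_zero k.succ_ne_zero
  have hn' := qpoch_q_ne_zero n
  have hk' := qpoch_q_ne_zero k
  rw [qbinom, qbinom, show n + 1 + k - (n + 1) = k by omega, show n + 1 + k - n = k + 1 by omega,
    qpoch_q_succ n, qpoch_q_succ k]
  field_simp

theorem qbinom_eq_prod (p n : ℕ) (hp : 1 ≤ p) (hn : n ≤ p - 1) :
    qbinom q (p - 1) n =
      (-1 : RatFunc ℚ) ^ n * (q ^ (n * (n + 1) / 2))⁻¹ *
        ∏ j ∈ Finset.Icc 1 n, (1 - qn q p / qn q j) := by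
  induction n with
  | zero => simp [qbinom, qpoch_q_ne_zero, show qpoch q q 0 = 1 from prod_range_zero _]
  | succ n ih =>
    obtain ⟨k, hk⟩ := Nat.exists_eq_add_of_le hn
    obtain rfl : p = n + 1 + (k + 1) := by omega
    have hexp : (n + 1) * (n + 1 + 1) / 2 = n * (n + 1) / 2 + (n + 1) := by
      rw [show (n + 1) * (n + 1 + 1) = n * (n + 1) + (n + 1) * 2 by ring,
        Nat.add_mul_div_right _ _ two_pos]
    have hq := pow_ne_zero (n + 1) q_ne_zero
    specialize ih (by omega)
    rw [hk] at ih ⊢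
    rw [qbinom_succ_right, ih, prod_Icc_succ_top (by omega), one_sub_qn_div_qn _ (Nat.add_one_ne_zero n),
      hexp, pow_add q _ (n + 1), mul_inv, pow_succ (-1 : RatFunc ℚ)]
    generalize (1 - q ^ (k + 1)) / (1 - q ^ (n + 1)) = r
    field_simp
end

section
/- Let p ≥ 5 be a prime and m ≥ 2 an integer with p ∤ m. Then (−1)^{Σ_{k=1}^{⌊m/2⌋} ⌊kp/m⌋} · q^{2m Σ_{k=1}^{⌊m/2⌋} C(⌊kp/m⌋+1,2)} · ∏_{k=1}^{⌊m/2⌋} [p−1 choose ⌊kp/m⌋]_{q^{2m}} ≡ 1 − [p]_{q^{2m}} · Σ_{j=1}^{(p−1)/2} (⌊m/2⌋ − ⌊jm/p⌋)/[j]_{q^{2m}} (mod [p]_{q^{2m}}^2), where C(a,2) = a(a−1)/2. -/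
open Polynomial Finset

/-- The rational functions whose reduced denominator is coprime to `g`. -/
noncomputable def regularSubring (g : ℚ[X]) : Subring (RatFunc ℚ) where
  carrier := {x | IsCoprime x.denom g}
  mul_mem' {x y} hx hy := by
    have hxy : IsCoprime (x.denom * y.denom) g := IsCoprime.mul_left hx hy
    exact hxy.of_isCoprime_of_dvd_left (RatFunc.denom_mul_dvd x y)
  one_mem' := by simp [RatFunc.denom_one, isCoprime_one_left]
  add_mem' {x y} hx hy := by
    have hxy : IsCoprime (x.denom * y.denom) g := IsCoprime.mul_left hx hy
    exact hxy.of_isCoprime_of_dvd_left (RatFunc.denom_add_dvd x y)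
  zero_mem' := by simp [RatFunc.denom_zero, isCoprime_one_left]
  neg_mem' {x} hx := by
    have h : (-x).denom ∣ x.denom :=
      (RatFunc.denom_dvd x.denom_ne_zero).2 ⟨-x.num, by rw [map_neg, neg_div, x.num_div_denom]⟩
    exact IsCoprime.of_isCoprime_of_dvd_left hx h

theorem mem_regularSubring {g : ℚ[X]} {x : RatFunc ℚ} :
    x ∈ regularSubring g ↔ IsCoprime x.denom g := Iff.rfl

theorem algebraMap_mem_regularSubring (g f : ℚ[X]) :
    algebraMap ℚ[X] (RatFunc ℚ) f ∈ regularSubring g := by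
  simp [mem_regularSubring, RatFunc.denom_algebraMap, isCoprime_one_left]

theorem inv_algebraMap_mem_regularSubring {g f : ℚ[X]} (hf : f ≠ 0) (h : IsCoprime f g) :
    (algebraMap ℚ[X] (RatFunc ℚ) f)⁻¹ ∈ regularSubring g := by
  refine h.of_isCoprime_of_dvd_left ((RatFunc.denom_dvd hf).2 ⟨1, ?_⟩)
  rw [map_one, one_div]

theorem exists_prod_one_sub_eq {K ι : Type*} [CommRing K] (A : Subring K) (N : K) (hN : N ∈ A)
    (s : Finset ι) (x : ι → K) (hx : ∀ i ∈ s, x i ∈ A) :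
    ∃ R ∈ A, ∏ i ∈ s, (1 - N * x i) = 1 - N * ∑ i ∈ s, x i + N ^ 2 * R := by
  classical
  induction s using Finset.induction_on with
  | empty => exact ⟨0, A.zero_mem, by simp⟩
  | insert i s hi ih =>
    obtain ⟨R, hR, h⟩ := ih fun j hj => hx j (mem_insert_of_mem hj)
    have hxi := hx i (mem_insert_self i s)
    have hS : ∑ j ∈ s, x j ∈ A := A.sum_mem fun j hj => hx j (mem_insert_of_mem hj)
    refine ⟨x i * (∑ j ∈ s, x j) + R - N * (x i * R),
      A.sub_mem (A.add_mem (A.mul_mem hxi hS) hR) (A.mul_mem hN (A.mul_mem hxi hR)), ?_⟩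
    rw [prod_insert hi, sum_insert hi, h]
    ring

theorem isCoprime_geom_sum {R : Type*} [CommRing R] (a : R) {j p : ℕ} (h : j.Coprime p)
    (hp : 1 < p) : IsCoprime (∑ i ∈ range j, a ^ i) (∑ i ∈ range p, a ^ i) := by
  have key (u v : ℕ) : ∑ i ∈ range (u * v), a ^ i =
      (∑ i ∈ range u, a ^ i) * ∑ i ∈ range v, (a ^ u) ^ i := by
    induction v with
    | zero => simp
    | succ v ih =>
      rw [Nat.mul_succ, sum_range_add, ih, sum_range_succ, mul_add, ← pow_mul, sum_mul, sum_mul]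
      simp only [pow_add, mul_comm]
  obtain ⟨t, ht⟩ := Nat.exists_mul_mod_eq_one_of_coprime h hp
  have hdiv : j * t = p * (j * t / p) + 1 := by rw [← ht.2, Nat.div_add_mod]
  refine ⟨∑ i ∈ range t, (a ^ j) ^ i, -(a * ∑ i ∈ range (j * t / p), (a ^ p) ^ i), ?_⟩
  have e := key j t
  rw [hdiv, sum_range_succ'] at e
  simp only [pow_succ, ← sum_mul] at e
  rw [key] at e
  linear_combination -e

theorem pqn_ne_zero (m : ℕ) {n : ℕ} (hn : n ≠ 0) : pqn (X ^ m) n ≠ 0 := by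
  intro h
  have := congrArg (eval 1) h
  simp [pqn, eval_finsetSum, hn] at this

theorem algebraMap_pqn (m n : ℕ) :
    algebraMap ℚ[X] (RatFunc ℚ) (pqn (X ^ m) n) = qn (q ^ m) n := by
  simp [pqn, qn, q]

theorem qpoch_self_succ (a : RatFunc ℚ) (n : ℕ) :
    qpoch a a (n + 1) = qpoch a a n * (1 - a ^ (n + 1)) := by
  rw [qpoch, prod_range_succ, ← pow_succ', qpoch]

theorem qpoch_self_ne_zero {a : RatFunc ℚ} (ha : ∀ i ≠ 0, 1 - a ^ i ≠ 0) (n : ℕ) :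
    qpoch a a n ≠ 0 :=
  prod_ne_zero_iff.2 fun i _ => by rw [← pow_succ']; exact ha _ i.succ_ne_zero

theorem qn_div_qn {a : RatFunc ℚ} (ha : a ≠ 1) (n j : ℕ) :
    qn a n / qn a j = (1 - a ^ n) / (1 - a ^ j) := by
  have h : 1 - a ≠ 0 := sub_ne_zero.2 ha.symm
  rw [← mul_neg_geom_sum, ← mul_neg_geom_sum, mul_div_mul_left _ _ h, qn, qn]

theorem neg_one_pow_mul_qbinom {a : RatFunc ℚ} (ha : ∀ i ≠ 0, 1 - a ^ i ≠ 0) (n d : ℕ) :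
    (-1) ^ n * a ^ (n + 1).choose 2 * qbinom a (n + d) n =
      ∏ j ∈ Icc 1 n, (1 - qn a (n + d + 1) / qn a j) := by
  have ha1 : a ≠ 1 := fun h => ha 1 one_ne_zero (by simp [h])
  simp only [qn_div_qn ha1]
  induction n generalizing d with
  | zero =>
    have := qpoch_self_ne_zero ha d
    simp only [qpoch] at this
    simp [qbinom, qpoch, this]
  | succ n ih =>
    rw [prod_Icc_succ_top (by omega), show n + 1 + d = n + (d + 1) by ring, ← ih (d + 1),
      show (n + 1 + 1).choose 2 = (n + 1) + (n + 1).choose 2 by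
        rw [Nat.choose_succ_succ' (n + 1) 1, Nat.choose_one_right]]
    simp only [qbinom, show n + (d + 1) - n = d + 1 by omega,
      show n + (d + 1) - (n + 1) = d by omega, qpoch_self_succ]
    have h1 := qpoch_self_ne_zero ha n
    have h2 := qpoch_self_ne_zero ha d
    have h3 := ha (n + 1) (by omega)
    have h4 := ha (d + 1) (by omega)
    field_simp
    ring

theorem sum_sum_Icc_mul_div {p m : ℕ} (hp : p.Prime) (hp5 : 5 ≤ p) (hm : 0 < m) (hpm : ¬ p ∣ m)
    {K : Type*} [CommRing K] (f : ℕ → K) :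
    ∑ k ∈ Icc 1 (m / 2), ∑ j ∈ Icc 1 (k * p / m), f j =
      ∑ j ∈ Icc 1 ((p - 1) / 2), (((m / 2 : ℕ) : K) - ((j * m / p : ℕ) : K)) * f j := by
  have hodd : p % 2 = 1 := Nat.odd_iff.1 (hp.odd_of_ne_two (by omega))
  rw [sum_comm' (t' := Icc 1 ((p - 1) / 2)) (s' := fun j => Icc (j * m / p + 1) (m / 2))]
  · refine sum_congr rfl fun j hj => ?_
    rw [mem_Icc] at hj
    have hle : j * m / p ≤ m / 2 := by
      rw [Nat.le_div_iff_mul_le two_pos]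
      have h1 := Nat.div_mul_le_self (j * m) p
      have h2 : 2 * j ≤ p := by omega
      refine Nat.le_of_mul_le_mul_right ?_ hp.pos
      nlinarith
    rw [sum_const, Nat.card_Icc, Nat.add_sub_add_right, nsmul_eq_mul, Nat.cast_sub hle]
  · intro k j
    simp only [mem_Icc, Nat.le_div_iff_mul_le hm, Nat.add_one_le_iff, Nat.div_lt_iff_lt_mul hp.pos]
    constructor
    · rintro ⟨⟨hk1, hk2⟩, hj1, hj2⟩
      have hk3 : 2 * k ≤ m := by omega
      have h2 : 2 * j ≤ p := by
        refine Nat.le_of_mul_le_mul_right ?_ hm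
        nlinarith
      refine ⟨⟨lt_of_le_of_ne hj2 fun h => ?_, hk2⟩, hj1, by omega⟩
      rcases hp.dvd_mul.1 (Dvd.intro_left k h.symm) with h' | h'
      · exact absurd (Nat.le_of_dvd hj1 h') (by omega)
      · exact hpm h'
    · rintro ⟨⟨h1, h2⟩, h3, -⟩
      refine ⟨⟨Nat.pos_of_ne_zero ?_, h2⟩, h3, h1.le⟩
      rintro rfl
      simp at h1

theorem product_qbinom_expansion (p : ℕ) (hp : p.Prime) (hp5 : 5 ≤ p)
    (m : ℕ) (hm : 2 ≤ m) (hpm : ¬ p ∣ m) :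
    qCong (pqn (Polynomial.X ^ (2 * m)) p ^ 2)
      ((-1 : RatFunc ℚ) ^ (∑ k ∈ Finset.Icc 1 (m / 2), k * p / m) *
        q ^ (2 * m * ∑ k ∈ Finset.Icc 1 (m / 2), (k * p / m + 1).choose 2) *
        ∏ k ∈ Finset.Icc 1 (m / 2), qbinom (q ^ (2 * m)) (p - 1) (k * p / m))
      (1 - qn (q ^ (2 * m)) p *
        ∑ j ∈ Finset.Icc 1 ((p - 1) / 2),
          (((m / 2 : ℕ) : RatFunc ℚ) - ((j * m / p : ℕ) : RatFunc ℚ)) /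
            qn (q ^ (2 * m)) j) := by
  have ha : ∀ i ≠ 0, 1 - (q ^ (2 * m)) ^ i ≠ 0 := fun i hi => by
    rw [← pow_mul]
    exact one_sub_q_pow_ne_zero (by positivity)
  have hlt : ∀ k ∈ Icc 1 (m / 2), k * p / m ≤ (p - 1) / 2 := fun k hk => by
    rw [mem_Icc] at hk
    have h1 := Nat.div_mul_le_self (k * p) m
    have h2 : 2 * k ≤ m := by omega
    have h3 : 2 * (k * p / m) ≤ p := by
      refine Nat.le_of_mul_le_mul_right ?_ (show 0 < m by omega)
      nlinarith
    have hodd : p % 2 = 1 := Nat.odd_iff.1 (hp.odd_of_ne_two (by omega))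
    omega
  have hprod : (-1 : RatFunc ℚ) ^ (∑ k ∈ Icc 1 (m / 2), k * p / m) *
      q ^ (2 * m * ∑ k ∈ Icc 1 (m / 2), (k * p / m + 1).choose 2) *
      ∏ k ∈ Icc 1 (m / 2), qbinom (q ^ (2 * m)) (p - 1) (k * p / m) =
      ∏ x ∈ (Icc 1 (m / 2)).sigma fun k => Icc 1 (k * p / m),
        (1 - qn (q ^ (2 * m)) p * (qn (q ^ (2 * m)) x.2)⁻¹) := by
    rw [pow_mul, ← prod_pow_eq_pow_sum, ← prod_pow_eq_pow_sum, ← prod_mul_distrib,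
      ← prod_mul_distrib, prod_sigma]
    refine prod_congr rfl fun k hk => ?_
    obtain ⟨d, hd⟩ := Nat.exists_eq_add_of_le (show k * p / m ≤ p - 1 by have := hlt k hk; omega)
    have h := neg_one_pow_mul_qbinom ha (k * p / m) d
    rw [← hd, Nat.sub_add_cancel hp.one_le] at h
    simpa only [div_eq_mul_inv] using h
  obtain ⟨R, hR, h⟩ := exists_prod_one_sub_eq (regularSubring (pqn (X ^ (2 * m)) p ^ 2))
    (qn (q ^ (2 * m)) p)
    (by rw [← algebraMap_pqn]; exact algebraMap_mem_regularSubring _ _)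
    ((Icc 1 (m / 2)).sigma fun k => Icc 1 (k * p / m))
    (fun x => (qn (q ^ (2 * m)) x.2)⁻¹) (by
      rintro ⟨k, j⟩ hkj
      rw [mem_sigma, mem_Icc (a := 1) (b := k * p / m)] at hkj
      obtain ⟨hk, hj1 : 1 ≤ j, hj2 : j ≤ k * p / m⟩ := hkj
      have hjp : j < p := by have := hlt k hk; omega
      have hcop : j.Coprime p := (Nat.coprime_of_lt_prime (Nat.ne_of_gt hj1) hjp hp).symm
      rw [← algebraMap_pqn]
      exact inv_algebraMap_mem_regularSubring (pqn_ne_zero _ (Nat.ne_of_gt hj1))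
        (isCoprime_geom_sum _ hcop hp.one_lt).pow_right)
  have hN : qn (q ^ (2 * m)) p ^ 2 ≠ 0 := by
    rw [← algebraMap_pqn]
    exact pow_ne_zero 2 (RatFunc.algebraMap_ne_zero (pqn_ne_zero _ hp.ne_zero))
  rw [sum_sigma, sum_sum_Icc_mul_div hp hp5 (by omega) hpm fun j => (qn (q ^ (2 * m)) j)⁻¹] at h
  rw [qCong, hprod, h, map_pow, algebraMap_pqn]
  simp only [div_eq_mul_inv, add_sub_cancel_left] at hR ⊢
  rwa [mul_comm (_ ^ 2) R, mul_assoc, mul_inv_cancel₀ hN, mul_one]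
end

section
/- Let p ≥ 5 be a prime and m ≥ 1 an integer with p ∤ m. Then [p]_{q^{2m}} · Σ_{j=1}^{(p−1)/2} 1/[j]_{q^{2m}} ≡ −2·[p]_{q^m}·Q_p(2,q^m) (mod [p]_{q^m}^2). -/
open Polynomial Finset

theorem sum_natCast_mul_pow_of_pow_eq_one {K : Type*} [Field K] {y : K} {p : ℕ}
    (hy : y ^ p = 1) (h1 : y ≠ 1) :
    ∑ k ∈ range p, (k : K) * y ^ k = p / (y - 1) := by
  have key : ∀ N : ℕ, (y - 1) * ∑ k ∈ range N, (k : K) * y ^ k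
      = N * y ^ N - y * ∑ k ∈ range N, y ^ k := by
    intro N
    induction N with
    | zero => simp
    | succ N ih =>
      rw [sum_range_succ, sum_range_succ, mul_add, ih]
      push_cast
      ring
  have h0 : y - 1 ≠ 0 := sub_ne_zero.mpr h1
  have hg : ∑ k ∈ range p, y ^ k = 0 := by
    rw [geom_sum_eq h1, hy, sub_self, zero_div]
  rw [eq_div_iff h0, mul_comm, key, hg, hy]
  ring

theorem sum_range_two_mul {M : Type*} [AddCommMonoid M] (f : ℕ → M) (n : ℕ) :
    ∑ i ∈ range (2 * n), f i = ∑ j ∈ range n, (f (2 * j) + f (2 * j + 1)) := by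
  induction n with
  | zero => simp
  | succ n ih =>
    rw [Nat.mul_succ, sum_range_succ, sum_range_succ, sum_range_succ, ih, add_assoc]

theorem one_add_pow_ne_zero_of_odd {K : Type*} [Field K] [CharZero K] {ζ : K} {n : ℕ}
    (hζ : ζ ^ (2 * n + 1) = 1) (k : ℕ) : 1 + ζ ^ k ≠ 0 := by
  intro h
  have h1 : (ζ ^ k) ^ (2 * n + 1) = 1 := by rw [← pow_mul, mul_comm, pow_mul, hζ, one_pow]
  have h2 : ζ ^ k = -1 := by linear_combination h
  rw [h2, Odd.neg_one_pow ⟨n, rfl⟩] at h1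
  norm_num at h1

theorem IsPrimitiveRoot.sum_alternating_inv_pow_sub_one {K : Type*} [Field K] {ζ : K} {n : ℕ}
    (hζ : IsPrimitiveRoot ζ (2 * n + 1)) :
    ∑ i ∈ range (2 * n), (-1) ^ i * (1 / (ζ ^ (i + 1) - 1))
      = 2 * ∑ j ∈ range n, 1 / (1 - ζ ^ (2 * (j + 1))) - n := by
  have hne : ∀ j ∈ range n, 1 - ζ ^ (2 * (j + 1)) ≠ 0 := fun j hj h => by
    have := mem_range.mp hj
    exact hζ.pow_ne_one_of_pos_of_lt (by omega) (by omega) (sub_eq_zero.mp h).symm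
  have hrefl : ∑ j ∈ range n, 1 / (ζ ^ (2 * j + 1) - 1)
      = ∑ j ∈ range n, (1 / (1 - ζ ^ (2 * (j + 1))) - 1) := by
    rw [← sum_range_reflect]
    refine sum_congr rfl fun j hj => ?_
    have hj' := mem_range.mp hj
    have h1 := hne j hj
    have h2 : ζ ^ (2 * (n - 1 - j) + 1) - 1 ≠ 0 := sub_ne_zero.mpr
      (hζ.pow_ne_one_of_pos_of_lt (by omega) (by omega))
    have h3 : ζ ^ (2 * (n - 1 - j) + 1) * ζ ^ (2 * (j + 1)) = 1 := by
      rw [← pow_add, ← hζ.pow_eq_one]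
      congr 1
      omega
    field_simp
    linear_combination -h3
  rw [sum_range_two_mul, sum_add_distrib]
  have he : ∀ j : ℕ, (-1 : K) ^ (2 * j) = 1 := fun j => by rw [pow_mul]; simp
  simp only [pow_succ (-1 : K), he, one_mul]
  rw [hrefl, sum_sub_distrib, two_mul]
  have : ∑ j ∈ range n, -1 * (1 / (ζ ^ (2 * j + 1 + 1) - 1))
      = ∑ j ∈ range n, 1 / (1 - ζ ^ (2 * (j + 1))) := by
    refine sum_congr rfl fun j _ => ?_
    rw [← neg_sub, one_div_neg_eq_neg_one_div]
    ring_nf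
  rw [this]
  simp only [sum_const, card_range, nsmul_eq_mul, mul_one]
  ring

theorem IsPrimitiveRoot.sum_natCast_mul_pow_div_one_add_pow {K : Type*} [Field K] [CharZero K]
    {ζ : K} {n : ℕ} (hζ : IsPrimitiveRoot ζ (2 * n + 1)) :
    ∑ k ∈ range (2 * n + 1), (k : K) * (ζ ^ k / (1 + ζ ^ k))
      = (2 * n + 1) * ∑ j ∈ range n, 1 / (1 - ζ ^ (2 * (j + 1))) := by
  have hp := hζ.pow_eq_one
  have hexp : ∀ k : ℕ, ζ ^ k / (1 + ζ ^ k)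
      = 1 / 2 * ∑ i ∈ range (2 * n + 1), (-1) ^ i * (ζ ^ (i + 1)) ^ k := by
    intro k
    have h0 := one_add_pow_ne_zero_of_odd hp k
    have hg := geom_sum_mul (-ζ ^ k) (2 * n + 1)
    rw [Odd.neg_pow ⟨n, rfl⟩, ← pow_mul, mul_comm k, pow_mul, hp, one_pow] at hg
    have hs : ∑ i ∈ range (2 * n + 1), (-1) ^ i * (ζ ^ (i + 1)) ^ k
        = ζ ^ k * ∑ i ∈ range (2 * n + 1), (-ζ ^ k) ^ i := by
      rw [mul_sum]
      refine sum_congr rfl fun i _ => ?_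
      rw [neg_pow (ζ ^ k)]
      ring
    rw [hs, div_eq_iff h0]
    linear_combination (ζ ^ k / 2) * hg
  simp_rw [hexp]
  have hswap : ∑ k ∈ range (2 * n + 1),
        (k : K) * (1 / 2 * ∑ i ∈ range (2 * n + 1), (-1) ^ i * (ζ ^ (i + 1)) ^ k)
      = 1 / 2 * ∑ i ∈ range (2 * n + 1),
          (-1) ^ i * ∑ k ∈ range (2 * n + 1), (k : K) * (ζ ^ (i + 1)) ^ k := by
    simp_rw [mul_sum]
    rw [sum_comm]
    refine sum_congr rfl fun i _ => sum_congr rfl fun k _ => ?_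
    ring
  rw [hswap, sum_range_succ, hp]
  have hgauss : ∑ k ∈ range (2 * n + 1), (k : K) = (2 * n + 1) * n := by
    have := Finset.sum_range_id_mul_two (2 * n + 1)
    rw [Nat.add_sub_cancel] at this
    have h2 : (∑ k ∈ range (2 * n + 1), (k : K)) * 2 = (2 * n + 1) * (2 * n) := by
      simpa using congrArg (Nat.cast : ℕ → K) this
    linear_combination h2 / 2
  have hterm : ∑ i ∈ range (2 * n), (-1) ^ i * ∑ k ∈ range (2 * n + 1), (k : K) * (ζ ^ (i + 1)) ^ k
      = (2 * n + 1) * ∑ i ∈ range (2 * n), (-1) ^ i * (1 / (ζ ^ (i + 1) - 1)) := by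
    rw [mul_sum]
    refine sum_congr rfl fun i hi => ?_
    have := mem_range.mp hi
    rw [sum_natCast_mul_pow_of_pow_eq_one (by rw [← pow_mul, mul_comm, pow_mul, hp, one_pow])
      (hζ.pow_ne_one_of_pos_of_lt (by omega) (by omega))]
    push_cast
    ring
  simp only [one_pow, mul_one]
  rw [hterm, hζ.sum_alternating_inv_pow_sub_one, hgauss, pow_mul]
  norm_num
  ring

theorem IsPrimitiveRoot.prod_one_add_pow {K : Type*} [Field K] [CharZero K] {ζ : K} {n : ℕ}
    (hζ : IsPrimitiveRoot ζ (2 * n + 1)) : ∏ k ∈ range (2 * n), (1 + ζ ^ (k + 1)) = 1 := by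
  have h := hζ.pow_add_pow_eq_prod_add_mul 1 1 ⟨n, rfl⟩
  have himg : ∏ k ∈ range (2 * n + 1), (1 + ζ ^ k)
      = ∏ ξ ∈ nthRootsFinset (2 * n + 1) (1 : K), (1 + ξ * 1) := by
    refine prod_nbij (fun k => ζ ^ k) ?_ ?_ ?_ ?_
    · intro k _
      rw [Polynomial.mem_nthRootsFinset (by omega) 1, ← pow_mul, mul_comm, pow_mul, hζ.pow_eq_one, one_pow]
    · intro i hi j hj hij
      exact hζ.pow_inj (by simpa using hi) (by simpa using hj) hij
    · intro ξ hξ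
      rw [mem_coe, Polynomial.mem_nthRootsFinset (by omega) 1] at hξ
      obtain ⟨i, hi, rfl⟩ := hζ.eq_pow_of_pow_eq_one hξ
      exact ⟨i, by simpa using hi, rfl⟩
    · intro k _
      rw [mul_one]
  rw [← himg, prod_range_succ'] at h
  simp only [one_pow, pow_zero] at h
  linear_combination -h / 2

theorem cyclotomic_dvd_of_aeval_eq_zero {p : ℕ} (hp : 0 < p) {ζ : ℂ} (hζ : IsPrimitiveRoot ζ p)
    {F : ℚ[X]} (h : aeval ζ F = 0) : cyclotomic p ℚ ∣ F := by
  rw [cyclotomic_eq_minpoly_rat hζ hp]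
  exact minpoly.dvd ℚ ζ h

theorem cyclotomic_sq_dvd_of_aeval_eq_zero {p : ℕ} (hp : 0 < p) {ζ : ℂ}
    (hζ : IsPrimitiveRoot ζ p) {F : ℚ[X]} (h : aeval ζ F = 0) (h' : aeval ζ (derivative F) = 0) :
    cyclotomic p ℚ ^ 2 ∣ F := by
  obtain ⟨G, rfl⟩ := cyclotomic_dvd_of_aeval_eq_zero hp hζ h
  have hd := cyclotomic_dvd_of_aeval_eq_zero hp hζ h'
  rw [derivative_mul, dvd_add_left (dvd_mul_right _ _)] at hd
  have hsep : IsCoprime (cyclotomic p ℚ) (derivative (cyclotomic p ℚ)) :=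
    (cyclotomic.irreducible_rat hp).separable
  rw [sq]
  exact mul_dvd_mul_left _ (hsep.dvd_of_dvd_mul_left hd)

theorem aeval_prod_one_sub_X_pow_ne_zero {ζ : ℂ} {n : ℕ} (hζ : IsPrimitiveRoot ζ (2 * n + 1)) :
    aeval ζ (∏ j ∈ range n, (1 - X ^ (2 * (j + 1)) : ℚ[X])) ≠ 0 := by
  simp only [map_prod, map_sub, map_one, map_pow, aeval_X]
  refine prod_ne_zero_iff.mpr fun j hj h => ?_
  have := mem_range.mp hj
  exact hζ.pow_ne_one_of_pos_of_lt (by omega) (by omega) (sub_eq_zero.mp h).symm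

/-- The numerator of the difference of both sides, written in the base `X`. -/
theorem cyclotomic_sq_dvd_numerator {n : ℕ} :
    cyclotomic (2 * n + 1) ℚ ^ 2 ∣
      (1 - X ^ (2 * (2 * n + 1)))
          * ∑ j ∈ range n, ∏ i ∈ (range n).erase j, (1 - X ^ (2 * (i + 1)))
        + 2 * (∏ j ∈ range n, (1 - X ^ (2 * (j + 1))))
          * (∏ k ∈ range (2 * n), (1 + X ^ (k + 1)) - 1) := by
  have hζ := Complex.isPrimitiveRoot_exp (2 * n + 1) (by omega)
  set ζ := Complex.exp (2 * Real.pi * Complex.I / (2 * n + 1 : ℕ))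
  have hζ0 : ζ ≠ 0 := hζ.ne_zero (by omega)
  have hD := aeval_prod_one_sub_X_pow_ne_zero hζ
  set D : ℚ[X] := ∏ j ∈ range n, (1 - X ^ (2 * (j + 1)))
  have hp := hζ.pow_eq_one
  have hp2 : ζ ^ (2 * (2 * n + 1)) = 1 := by rw [mul_comm, pow_mul, hp, one_pow]
  have hP : aeval ζ (∏ k ∈ range (2 * n), (1 + X ^ (k + 1)) : ℚ[X]) = 1 := by
    simpa using hζ.prod_one_add_pow
  have hE : aeval ζ (∑ j ∈ range n, ∏ i ∈ (range n).erase j, (1 - X ^ (2 * (i + 1))) : ℚ[X])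
      = aeval ζ D * ∑ j ∈ range n, 1 / (1 - ζ ^ (2 * (j + 1))) := by
    rw [map_sum, mul_sum]
    refine sum_congr rfl fun j hj => ?_
    have hj' := mem_range.mp hj
    have h1 : 1 - ζ ^ (2 * (j + 1)) ≠ 0 := fun h =>
      hζ.pow_ne_one_of_pos_of_lt (by omega) (by omega) (sub_eq_zero.mp h).symm
    rw [mul_one_div, eq_div_iff h1]
    simp only [D]
    rw [← prod_erase_mul _ _ hj, map_mul]
    simp
  have hP' : ζ * aeval ζ (derivative (∏ k ∈ range (2 * n), (1 + X ^ (k + 1)) : ℚ[X]))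
      = (2 * n + 1) * ∑ j ∈ range n, 1 / (1 - ζ ^ (2 * (j + 1))) := by
    rw [← hζ.sum_natCast_mul_pow_div_one_add_pow, derivative_prod_finset, map_sum, mul_sum,
      sum_range_succ']
    simp only [Nat.cast_zero, zero_mul, add_zero]
    refine sum_congr rfl fun k hk => ?_
    have h1 := one_add_pow_ne_zero_of_odd hp (k + 1)
    have h2 : aeval ζ (∏ b ∈ (range (2 * n)).erase k, (1 + X ^ (b + 1)) : ℚ[X])
        * (1 + ζ ^ (k + 1)) = 1 := by
      have h := hP
      rw [← prod_erase_mul _ _ hk, map_mul] at h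
      simpa using h
    rw [map_mul, eq_div_of_mul_eq h1 h2]
    simp only [derivative_add, derivative_one, derivative_X_pow, zero_add,
      map_mul, map_pow, aeval_X, map_natCast, Nat.add_sub_cancel]
    push_cast
    field_simp
    rw [pow_succ']
  refine cyclotomic_sq_dvd_of_aeval_eq_zero (by omega) hζ ?_ ?_
  · simp only [map_add, map_mul, map_sub, map_one, map_pow, aeval_X, hp2, hP]
    ring
  · refine (mul_eq_zero_iff_left hζ0).mp ?_
    have hd : aeval ζ (derivative (1 - X ^ (2 * (2 * n + 1)) : ℚ[X])) * ζ = -(2 * (2 * n + 1)) := by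
      simp only [derivative_sub, derivative_one, derivative_X_pow, zero_sub, map_neg, map_mul,
        map_pow, aeval_X, map_natCast, neg_mul, mul_assoc]
      rw [← pow_succ, show 2 * (2 * n + 1) - 1 + 1 = 2 * (2 * n + 1) by omega, hp2]
      simp
    have hP1 : ∀ P : ℚ[X], derivative (P - 1) = derivative P := fun P => by
      rw [derivative_sub, derivative_one, sub_zero]
    rw [derivative_add, derivative_mul, derivative_mul, hP1]
    simp only [map_add, map_mul, map_sub _ (1 : ℚ[X]), map_sub _ _ (1 : ℚ[X]),
      map_one, map_pow, aeval_X, hp2, hP, hE]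
    rw [derivative_sub] at hd
    simp only [map_ofNat]
    linear_combination (aeval ζ D * ∑ j ∈ range n, 1 / (1 - ζ ^ (2 * (j + 1)))) * hd
      + 2 * aeval ζ D * hP'

theorem qCong_of_algebraMap_mul_sub_eq {g D F : ℚ[X]} {A B : RatFunc ℚ} (hg : g ≠ 0)
    (hD : D ≠ 0) (hDg : IsCoprime D g) (hF : g ∣ F)
    (h : algebraMap ℚ[X] (RatFunc ℚ) D * (A - B) = algebraMap ℚ[X] (RatFunc ℚ) F) :
    qCong g A B := by
  obtain ⟨G, rfl⟩ := hF
  have hg' : algebraMap ℚ[X] (RatFunc ℚ) g ≠ 0 := RatFunc.algebraMap_ne_zero hg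
  have hD' : algebraMap ℚ[X] (RatFunc ℚ) D ≠ 0 := RatFunc.algebraMap_ne_zero hD
  have : (A - B) / algebraMap ℚ[X] (RatFunc ℚ) g
      = algebraMap ℚ[X] (RatFunc ℚ) G / algebraMap ℚ[X] (RatFunc ℚ) D := by
    rw [div_eq_div_iff hg' hD', mul_comm, h, map_mul, mul_comm]
  unfold qCong
  rw [this]
  exact hDg.of_isCoprime_of_dvd_left (RatFunc.denom_div_dvd _ _)

theorem q_pow_pow_ne_one {m k : ℕ} (hm : m ≠ 0) (hk : k ≠ 0) : (q ^ m) ^ k ≠ 1 := by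
  intro h
  rw [q, ← pow_mul, ← map_pow, ← map_one (algebraMap ℚ[X] (RatFunc ℚ))] at h
  have := congrArg natDegree (RatFunc.algebraMap_injective ℚ h)
  rw [natDegree_X_pow, natDegree_one] at this
  exact mul_ne_zero hm hk this

theorem qn_ne_zero {m n : ℕ} (hm : m ≠ 0) (hn : n ≠ 0) : qn (q ^ m) n ≠ 0 := by
  intro h
  have := geom_sum_mul (q ^ m) n
  rw [← qn, h, zero_mul] at this
  exact q_pow_pow_ne_one hm hn (sub_eq_zero.mp this.symm)

theorem algebraMap_expand (m : ℕ) (f : ℚ[X]) :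
    algebraMap ℚ[X] (RatFunc ℚ) (expand ℚ m f) = aeval (q ^ m) f := by
  have : (IsScalarTower.toAlgHom ℚ ℚ[X] (RatFunc ℚ)).comp (expand ℚ m) = aeval (q ^ m) := by
    ext
    simp [q]
  exact DFunLike.congr_fun this f

theorem qn_mul_sum_inv_qn {a : RatFunc ℚ} (ha : a ≠ 1) (N n : ℕ) :
    qn a N * ∑ j ∈ Icc 1 n, 1 / qn a j = (1 - a ^ N) * ∑ j ∈ range n, 1 / (1 - a ^ (j + 1)) := by
  have h1 : a - 1 ≠ 0 := sub_ne_zero.mpr ha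
  have hI : ∑ j ∈ Icc 1 n, 1 / qn a j = ∑ j ∈ range n, 1 / qn a (j + 1) := by
    rw [range_eq_Ico, sum_Ico_add' (fun j => 1 / qn a j), zero_add, Ico_add_one_right_eq_Icc]
  rw [hI, mul_sum, mul_sum]
  refine sum_congr rfl fun j _ => ?_
  rw [qn, qn, geom_sum_eq ha, geom_sum_eq ha, one_div_div, div_mul_div_cancel₀ h1, mul_one_div,
    ← neg_sub, ← neg_sub (1 : RatFunc ℚ), neg_div_neg_eq]

theorem qpoch_sq_div_qpoch {m : ℕ} (hm : m ≠ 0) (N : ℕ) :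
    qpoch ((q ^ m) ^ 2) ((q ^ m) ^ 2) N / qpoch (q ^ m) (q ^ m) N
      = ∏ k ∈ range N, (1 + (q ^ m) ^ (k + 1)) := by
  rw [qpoch, qpoch, ← prod_div_distrib]
  refine prod_congr rfl fun k _ => ?_
  have h : 1 - (q ^ m) * (q ^ m) ^ k ≠ 0 := by
    rw [← pow_succ']
    exact sub_ne_zero.mpr (q_pow_pow_ne_one hm k.succ_ne_zero).symm
  rw [div_eq_iff h]
  ring

theorem sum_inv_qn_two_m_congruence (p : ℕ) (hp : p.Prime) (hp5 : 5 ≤ p)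
    (m : ℕ) (hm : 1 ≤ m) (hpm : ¬ p ∣ m) :
    qCong (pqn (Polynomial.X ^ m) p ^ 2)
      (qn (q ^ (2 * m)) p * ∑ j ∈ Finset.Icc 1 ((p - 1) / 2), 1 / qn (q ^ (2 * m)) j)
      (-2 * qn (q ^ m) p * QF p 2 (q ^ m)) := by
  obtain ⟨n, rfl⟩ := hp.odd_of_ne_two (by omega)
  have hm0 : m ≠ 0 := by omega
  have := Fact.mk hp
  have hζ := Complex.isPrimitiveRoot_exp (2 * n + 1) (by omega)
  have hDζ := aeval_prod_one_sub_X_pow_ne_zero hζ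
  have hg : pqn (X ^ m) (2 * n + 1) ^ 2 = expand ℚ m (cyclotomic (2 * n + 1) ℚ ^ 2) := by
    rw [cyclotomic_prime, map_pow, pqn]
    simp
  have hD0 : ∏ j ∈ range n, (1 - X ^ (2 * (j + 1)) : ℚ[X]) ≠ 0 := fun h => by
    rw [h, map_zero] at hDζ
    exact hDζ rfl
  have hcop : IsCoprime (∏ j ∈ range n, (1 - X ^ (2 * (j + 1)) : ℚ[X]))
      (cyclotomic (2 * n + 1) ℚ ^ 2) := by
    refine IsCoprime.pow_right (IsCoprime.symm ?_)
    refine (cyclotomic.irreducible_rat (by omega)).coprime_iff_not_dvd.mpr fun ⟨G, hG⟩ => hDζ ?_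
    rw [hG, map_mul, cyclotomic_eq_minpoly_rat hζ (by omega), minpoly.aeval, zero_mul]
  rw [hg]
  have hcop' := hcop.map (expand ℚ m).toRingHom
  have hdvd := map_dvd (expand ℚ m) (cyclotomic_sq_dvd_numerator (n := n))
  refine qCong_of_algebraMap_mul_sub_eq ?_ ((expand_ne_zero hm).mpr hD0) hcop' hdvd ?_
  · exact (expand_ne_zero hm).mpr (pow_ne_zero _ (cyclotomic_ne_zero _ _))
  have ha2 : q ^ (2 * m) = (q ^ m) ^ 2 := by rw [← pow_mul, mul_comm]
  have hne : (q ^ m) ^ 2 ≠ 1 := q_pow_pow_ne_one hm0 two_ne_zero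
  have hB : -2 * qn (q ^ m) (2 * n + 1) * QF (2 * n + 1) 2 (q ^ m)
      = -2 * (∏ k ∈ range (2 * n), (1 + (q ^ m) ^ (k + 1)) - 1) := by
    rw [QF, Nat.add_sub_cancel, qpoch_sq_div_qpoch hm0, mul_assoc,
      mul_div_cancel₀ _ (qn_ne_zero hm0 (by omega))]
  rw [ha2, qn_mul_sum_inv_qn hne, hB, show (2 * n + 1 - 1) / 2 = n by omega,
    algebraMap_expand, algebraMap_expand]
  have hE : ∑ j ∈ range n, ∏ i ∈ (range n).erase j, (1 - (q ^ m) ^ (2 * (i + 1)))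
      = (∏ j ∈ range n, (1 - (q ^ m) ^ (2 * (j + 1))))
        * ∑ j ∈ range n, 1 / (1 - ((q ^ m) ^ 2) ^ (j + 1)) := by
    rw [mul_sum]
    refine sum_congr rfl fun j hj => ?_
    have h : 1 - (q ^ m) ^ (2 * (j + 1)) ≠ 0 :=
      sub_ne_zero.mpr (q_pow_pow_ne_one hm0 (by omega)).symm
    rw [← pow_mul, mul_one_div, eq_div_iff h, prod_erase_mul _ _ hj]
  simp only [map_add, map_mul, map_sub, map_one, map_pow, aeval_X, map_prod, map_sum, map_ofNat]
  rw [hE, ← pow_mul (q ^ m) 2 (2 * n + 1)]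
  ring
end

section
/- Let p ≥ 5 be a prime and m ≥ 1 an integer with p ∤ m. Then Σ_{j∈R_p(m)} q^{2jm}/[jm]_{q^2} ≡ ((1+q)/2)·Q_p(2,q) − ((1+q^m)/(2[m]_{q^2}))·Q_p(2,q^m) − (|R_p(m)|/2)·(1−q^2) (mod [p]_q). -/
open Polynomial Finset

/-- The rational function `A` is regular at `z` and takes the value `c` there. -/
def HasValueAt (z : ℂ) (A : RatFunc ℚ) (c : ℂ) : Prop :=
  ∃ n d : ℚ[X], A = algebraMap ℚ[X] (RatFunc ℚ) n / algebraMap ℚ[X] (RatFunc ℚ) d ∧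
    aeval z d ≠ 0 ∧ c = aeval z n / aeval z d

namespace HasValueAt

variable {z : ℂ} {A B : RatFunc ℚ} {a b : ℂ}

lemma algebraMap_ne_zero {d : ℚ[X]} (h : aeval z d ≠ 0) :
    algebraMap ℚ[X] (RatFunc ℚ) d ≠ 0 := by
  intro h0
  rw [map_eq_zero_iff _ (IsFractionRing.injective ℚ[X] (RatFunc ℚ))] at h0
  simp [h0] at h

lemma of_polynomial (z : ℂ) (n : ℚ[X]) :
    HasValueAt z (algebraMap ℚ[X] (RatFunc ℚ) n) (aeval z n) :=
  ⟨n, 1, by simp, by simp, by simp⟩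

lemma congr_value (hA : HasValueAt z A a) (h : a = b) : HasValueAt z A b := h ▸ hA

lemma indeterminate (z : ℂ) : HasValueAt z q z :=
  (of_polynomial z X).congr_value (by simp)

lemma const (z : ℂ) (n : ℕ) : HasValueAt z (n : RatFunc ℚ) n := by
  simpa using of_polynomial z (n : ℚ[X])

lemma one (z : ℂ) : HasValueAt z 1 1 := by simpa using const z 1

lemma add (hA : HasValueAt z A a) (hB : HasValueAt z B b) : HasValueAt z (A + B) (a + b) := by
  obtain ⟨n, d, rfl, hd, rfl⟩ := hA
  obtain ⟨n', d', rfl, hd', rfl⟩ := hB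
  refine ⟨n * d' + d * n', d * d', ?_, by simp [hd, hd'], ?_⟩
  · rw [div_add_div _ _ (algebraMap_ne_zero hd) (algebraMap_ne_zero hd')]
    simp
  · rw [div_add_div _ _ hd hd']
    simp

lemma mul (hA : HasValueAt z A a) (hB : HasValueAt z B b) : HasValueAt z (A * B) (a * b) := by
  obtain ⟨n, d, rfl, hd, rfl⟩ := hA
  obtain ⟨n', d', rfl, hd', rfl⟩ := hB
  exact ⟨n * n', d * d', by simp [div_mul_div_comm], by simp [hd, hd'],
    by simp [div_mul_div_comm]⟩

lemma neg (hA : HasValueAt z A a) : HasValueAt z (-A) (-a) := by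
  obtain ⟨n, d, rfl, hd, rfl⟩ := hA
  exact ⟨-n, d, by simp [neg_div], hd, by simp [neg_div]⟩

lemma sub (hA : HasValueAt z A a) (hB : HasValueAt z B b) : HasValueAt z (A - B) (a - b) := by
  simpa only [sub_eq_add_neg] using hA.add hB.neg

lemma div (hA : HasValueAt z A a) (hB : HasValueAt z B b) (hb : b ≠ 0) :
    HasValueAt z (A / B) (a / b) := by
  obtain ⟨n, d, rfl, hd, rfl⟩ := hA
  obtain ⟨n', d', rfl, hd', rfl⟩ := hB
  have hn' : aeval z n' ≠ 0 := fun h => hb (by simp [h])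
  exact ⟨n * d', d * n', by simp [div_div_div_eq], by simp [hd, hn'],
    by simp [div_div_div_eq]⟩

lemma pow (hA : HasValueAt z A a) (k : ℕ) : HasValueAt z (A ^ k) (a ^ k) := by
  induction k with
  | zero => simpa using one z
  | succ k ih => simpa only [pow_succ] using ih.mul hA

lemma sum {ι : Type*} (s : Finset ι) {F : ι → RatFunc ℚ} {f : ι → ℂ}
    (h : ∀ i ∈ s, HasValueAt z (F i) (f i)) : HasValueAt z (∑ i ∈ s, F i) (∑ i ∈ s, f i) := by
  classical
  induction s using Finset.induction_on with
  | empty => simpa using const z 0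
  | insert i s hi ih =>
    rw [sum_insert hi, sum_insert hi]
    exact (h i (mem_insert_self i s)).add (ih fun j hj => h j (mem_insert_of_mem hj))

lemma qn (hA : HasValueAt z A a) (k : ℕ) : HasValueAt z (qn A k) (∑ i ∈ range k, a ^ i) :=
  sum _ fun i _ => hA.pow i

end HasValueAt

section PrimitiveRoot

variable {p : ℕ} {z : ℂ}

lemma pqn_X_eq_cyclotomic (hp : p.Prime) : pqn X p = cyclotomic p ℚ := by
  have := Fact.mk hp
  rw [cyclotomic_prime, pqn]

lemma pqn_X_dvd_iff (hp : p.Prime) (hz : IsPrimitiveRoot z p) (n : ℚ[X]) :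
    pqn X p ∣ n ↔ aeval z n = 0 := by
  rw [pqn_X_eq_cyclotomic hp, cyclotomic_eq_minpoly_rat hz hp.pos, minpoly.dvd_iff]

lemma pqn_X_irreducible (hp : p.Prime) : Irreducible (pqn X p) := by
  rw [pqn_X_eq_cyclotomic hp]
  exact cyclotomic.irreducible_rat hp.pos

lemma isCoprime_pqn_X (hp : p.Prime) (hz : IsPrimitiveRoot z p) {d : ℚ[X]}
    (hd : aeval z d ≠ 0) : IsCoprime d (pqn X p) :=
  (((pqn_X_irreducible hp).coprime_iff_not_dvd).2
    fun h => hd ((pqn_X_dvd_iff hp hz d).1 h)).symm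

lemma qCong_of_hasValueAt (hp : p.Prime) (hz : IsPrimitiveRoot z p) {A B : RatFunc ℚ} {c : ℂ}
    (hA : HasValueAt z A c) (hB : HasValueAt z B c) : qCong (pqn X p) A B := by
  obtain ⟨n, d, hAB, hd, hc⟩ := hA.sub hB
  have hn : aeval z n = 0 := by
    rw [sub_self, eq_comm, div_eq_zero_iff] at hc
    exact hc.resolve_right hd
  obtain ⟨k, rfl⟩ := (pqn_X_dvd_iff hp hz n).2 hn
  have hg : algebraMap ℚ[X] (RatFunc ℚ) (pqn X p) ≠ 0 := by
    rw [Ne, map_eq_zero_iff _ (IsFractionRing.injective ℚ[X] (RatFunc ℚ))]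
    exact (pqn_X_irreducible hp).ne_zero
  have hq : (A - B) / algebraMap ℚ[X] (RatFunc ℚ) (pqn X p) =
      algebraMap ℚ[X] (RatFunc ℚ) k / algebraMap ℚ[X] (RatFunc ℚ) d := by
    rw [hAB, map_mul, div_right_comm, mul_div_cancel_left₀ _ hg]
  rw [qCong, hq]
  exact (isCoprime_pqn_X hp hz hd).of_isCoprime_of_dvd_left (RatFunc.denom_div_dvd k d)

/-- The value of a quotient at a common zero which is a simple zero of the denominator. -/
lemma hasValueAt_div_of_derivative (hp : p.Prime) (hz : IsPrimitiveRoot z p) {n d : ℚ[X]}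
    (hn : aeval z n = 0) (hd : aeval z d = 0) (hd' : aeval z (derivative d) ≠ 0) :
    HasValueAt z (algebraMap ℚ[X] (RatFunc ℚ) n / algebraMap ℚ[X] (RatFunc ℚ) d)
      (aeval z (derivative n) / aeval z (derivative d)) := by
  have hg0 : aeval z (pqn X p) = 0 := (pqn_X_dvd_iff hp hz _).1 dvd_rfl
  obtain ⟨k, rfl⟩ := (pqn_X_dvd_iff hp hz n).2 hn
  obtain ⟨l, rfl⟩ := (pqn_X_dvd_iff hp hz d).2 hd
  have hg : algebraMap ℚ[X] (RatFunc ℚ) (pqn X p) ≠ 0 := by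
    rw [Ne, map_eq_zero_iff _ (IsFractionRing.injective ℚ[X] (RatFunc ℚ))]
    exact (pqn_X_irreducible hp).ne_zero
  simp only [derivative_mul, map_add, map_mul, hg0, zero_mul, add_zero] at hd' ⊢
  exact ⟨k, l, mul_div_mul_left _ _ hg, right_ne_zero_of_mul hd',
    mul_div_mul_left _ _ (left_ne_zero_of_mul hd')⟩

lemma one_sub_pow_ne_zero (hz : IsPrimitiveRoot z p) {k : ℕ} (hk : ¬ p ∣ k) : 1 - z ^ k ≠ 0 :=
  sub_ne_zero.2 fun h => hk ((hz.pow_eq_one_iff_dvd k).1 h.symm)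

lemma aeval_derivative_pqn_X (hz : IsPrimitiveRoot z p) (hp : p.Prime) :
    z * (z - 1) * aeval z (derivative (pqn X p)) = p := by
  have h : pqn (X : ℚ[X]) p * (X - 1) = X ^ p - 1 := geom_sum_mul _ _
  have h' := congrArg (fun f => aeval z (derivative f)) h
  have hg0 : aeval z (pqn X p) = 0 := (pqn_X_dvd_iff hp hz _).1 dvd_rfl
  simp [derivative_mul, hg0, derivative_X_pow] at h'
  have hpow : z ^ (p - 1) * z = 1 := by
    rw [← pow_succ, Nat.sub_add_cancel hp.one_le, hz.pow_eq_one]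
  linear_combination z * h' + (p : ℂ) * hpow

lemma not_dvd_of_pos_of_lt {k : ℕ} (h0 : 0 < k) (h : k < p) : ¬ p ∣ k :=
  fun hd => absurd (Nat.le_of_dvd h0 hd) (by omega)

lemma one_add_pow_ne_zero (hz : IsPrimitiveRoot z p) (hp : p.Prime) (hp2 : p ≠ 2) {k : ℕ}
    (hk : ¬ p ∣ k) : 1 + z ^ k ≠ 0 := by
  intro h
  refine one_sub_pow_ne_zero hz (k := 2 * k) (fun hd => ?_)
    (by rw [mul_comm, pow_mul]; linear_combination (1 - z ^ k) * h)
  exact hk (((Nat.coprime_primes hp Nat.prime_two).2 hp2).dvd_of_dvd_mul_left hd)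

end PrimitiveRoot

@[to_additive]
lemma prod_range_even_mul_odd {M : Type*} [CommMonoid M] (f : ℕ → M) (h : ℕ) :
    ∏ i ∈ range (2 * h), f i = (∏ j ∈ range h, f (2 * j)) * ∏ j ∈ range h, f (2 * j + 1) := by
  induction h with
  | zero => simp
  | succ h ih =>
    rw [mul_add_one, prod_range_succ, prod_range_succ, ih, prod_range_succ _ h,
      prod_range_succ _ h]
    ac_rfl

section FermatQuotient

variable {h : ℕ} {z : ℂ}

lemma prod_one_add_pow (hz : IsPrimitiveRoot z (2 * h + 1)) :
    ∏ i ∈ range (2 * h), (1 + z ^ (i + 1)) = 1 := by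
  have hne : ∏ i ∈ range (2 * h), (1 - z ^ (i + 1)) ≠ 0 := by
    refine prod_ne_zero_iff.2 fun i hi => one_sub_pow_ne_zero hz ?_
    exact not_dvd_of_pos_of_lt (by omega) (by have := mem_range.1 hi; omega)
  refine mul_right_cancel₀ hne ?_
  rw [← prod_mul_distrib, one_mul, prod_range_even_mul_odd (fun i => 1 - z ^ (i + 1)), two_mul,
    prod_range_add, mul_comm]
  congr 1
  · refine prod_congr rfl fun i _ => ?_
    have : z ^ (h + i + 1) * z ^ (h + i + 1) = z ^ (2 * i + 1) := by
      rw [← pow_add, show h + i + 1 + (h + i + 1) = (2 * h + 1) + (2 * i + 1) by ring, pow_add,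
        hz.pow_eq_one, one_mul]
    linear_combination -this
  · refine prod_congr rfl fun i _ => ?_
    ring

lemma sum_mul_pow_div_one_add_pow (hp : (2 * h + 1).Prime) (hz : IsPrimitiveRoot z (2 * h + 1)) :
    ∑ i ∈ range (2 * h), ((i + 1 : ℕ) : ℂ) * z ^ (i + 1) / (1 + z ^ (i + 1)) =
      ((2 * h + 1 : ℕ) : ℂ) * ∑ j ∈ range h, 1 / (1 - z ^ (2 * (j + 1))) := by
  have hpow := hz.pow_eq_one
  set s : ℕ → ℂ := fun k => z ^ k / (1 - z ^ k) with hs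
  have hshift : ∀ k, s (2 * h + 1 + k) = s k := fun k => by simp [hs, pow_add, hpow]
  have hsplit : ∀ i ∈ range (2 * h), ((i + 1 : ℕ) : ℂ) * z ^ (i + 1) / (1 + z ^ (i + 1)) =
      ((i + 1 : ℕ) : ℂ) * s (i + 1) - (2 * (i + 1) : ℕ) * s (2 * (i + 1)) := by
    intro i hi
    have hnd : ¬ 2 * h + 1 ∣ i + 1 :=
      not_dvd_of_pos_of_lt (by omega) (by have := mem_range.1 hi; omega)
    have h1 := one_sub_pow_ne_zero hz hnd
    have h2 := one_add_pow_ne_zero hz hp (by omega) hnd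
    have h3 : 1 - z ^ (2 * (i + 1)) = (1 - z ^ (i + 1)) * (1 + z ^ (i + 1)) := by ring
    simp only [hs]
    rw [h3, mul_comm 2 (i + 1), pow_mul]
    generalize z ^ (i + 1) = x at *
    field_simp
    push_cast
    ring
  have hdouble : ∑ i ∈ range (2 * h), ((2 * (i + 1) : ℕ) : ℂ) * s (2 * (i + 1)) =
      ∑ i ∈ range (2 * h), ((i + 1 : ℕ) : ℂ) * s (i + 1) +
        ((2 * h + 1 : ℕ) : ℂ) * ∑ j ∈ range h, s (2 * j + 1) := by
    rw [sum_range_even_add_odd (fun i => ((i + 1 : ℕ) : ℂ) * s (i + 1)) h, two_mul h, sum_range_add,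
      mul_sum]
    simp only [← sum_add_distrib]
    refine sum_congr rfl fun j _ => ?_
    rw [show 2 * (h + j + 1) = 2 * h + 1 + (2 * j + 1) by ring, hshift, mul_add_one 2 j]
    push_cast
    ring
  have hreflect : ∑ j ∈ range h, s (2 * j + 1) = -∑ j ∈ range h, 1 / (1 - z ^ (2 * (j + 1))) := by
    rw [← sum_range_reflect, ← sum_neg_distrib]
    refine sum_congr rfl fun j hj => ?_
    have hj := mem_range.1 hj
    have h1 := one_sub_pow_ne_zero hz (not_dvd_of_pos_of_lt (k := 2 * (j + 1)) (by omega) (by omega))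
    have h2 := one_sub_pow_ne_zero hz
      (not_dvd_of_pos_of_lt (k := 2 * (h - 1 - j) + 1) (by omega) (by omega))
    have h3 : z ^ (2 * (h - 1 - j) + 1) * z ^ (2 * (j + 1)) = 1 := by
      rw [← pow_add, show 2 * (h - 1 - j) + 1 + 2 * (j + 1) = 2 * h + 1 by omega, hpow]
    simp only [hs]
    rw [div_eq_iff h2, ← neg_div, div_mul_eq_mul_div, eq_div_iff h1]
    linear_combination -h3
  rw [sum_congr rfl hsplit, sum_sub_distrib, hdouble, hreflect]
  ring

lemma q_pow_ne_one_s16 {k : ℕ} (hk : 0 < k) : q ^ k ≠ 1 := by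
  intro h0
  rw [q, ← map_pow, ← map_one (algebraMap ℚ[X] (RatFunc ℚ))] at h0
  have := congrArg natDegree (IsFractionRing.injective ℚ[X] (RatFunc ℚ) h0)
  simp at this
  omega

lemma qpoch_sq_div_qpoch_s16 {a : RatFunc ℚ} (ha : ∀ i : ℕ, a ^ (i + 1) ≠ 1) (n : ℕ) :
    qpoch (a ^ 2) (a ^ 2) n / qpoch a a n = ∏ i ∈ range n, (1 + a ^ (i + 1)) := by
  rw [qpoch, qpoch, ← prod_div_distrib]
  refine prod_congr rfl fun i _ => ?_
  have : 1 - a * a ^ i ≠ 0 := sub_ne_zero.2 fun h => ha i (by rw [pow_succ', ← h])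
  rw [div_eq_iff this]
  ring

lemma hasValueAt_QF_two (hp : (2 * h + 1).Prime) (hz : IsPrimitiveRoot z (2 * h + 1)) {m : ℕ}
    (hm : 1 ≤ m) (hpm : ¬ 2 * h + 1 ∣ m) :
    HasValueAt z (QF (2 * h + 1) 2 (q ^ m))
      (-(1 - z ^ m) * ∑ j ∈ range h, 1 / (1 - z ^ (2 * (m * (j + 1))))) := by
  set w := z ^ m with hw
  have hwp : IsPrimitiveRoot w (2 * h + 1) :=
    hz.pow_of_coprime m ((hp.coprime_iff_not_dvd.2 hpm).symm)
  have hz0 : z ≠ 0 := hz.ne_zero (by omega)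
  have hw0 : w ≠ 0 := pow_ne_zero _ hz0
  set f : ℚ[X] := ∏ i ∈ range (2 * h), (1 + X ^ (i + 1)) with hf
  have hfw : aeval w f = 1 := by simpa [hf] using prod_one_add_pow hwp
  have hgw : aeval w (pqn X (2 * h + 1)) = 0 := (pqn_X_dvd_iff hp hwp _).1 dvd_rfl
  have hg' := aeval_derivative_pqn_X hwp hp
  have hf' : w * aeval w (derivative f) =
      ∑ i ∈ range (2 * h), ((i + 1 : ℕ) : ℂ) * w ^ (i + 1) / (1 + w ^ (i + 1)) := by
    rw [hf, derivative_prod_finset, map_sum, mul_sum]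
    refine sum_congr rfl fun i hi => ?_
    have hnd : ¬ 2 * h + 1 ∣ i + 1 :=
      not_dvd_of_pos_of_lt (by omega) (by have := mem_range.1 hi; omega)
    have hi0 := one_add_pow_ne_zero hwp hp (by omega) hnd
    have hP := prod_one_add_pow hwp
    rw [← mul_prod_erase _ _ hi] at hP
    rw [eq_div_iff hi0]
    simp at hP ⊢
    linear_combination ((i : ℂ) + 1) * w ^ (i + 1) * hP
  have hQ : QF (2 * h + 1) 2 (q ^ m) =
      algebraMap ℚ[X] (RatFunc ℚ) ((f - 1).comp (X ^ m)) /
        algebraMap ℚ[X] (RatFunc ℚ) ((pqn X (2 * h + 1)).comp (X ^ m)) := by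
    rw [QF, qpoch_sq_div_qpoch_s16]
    · simp [hf, pqn, qn, q, Polynomial.prod_comp, Polynomial.sum_comp]
    · intro i
      rw [← pow_mul]
      exact q_pow_ne_one_s16 (by positivity)
  have hp0 : ((2 * h + 1 : ℕ) : ℂ) ≠ 0 := Nat.cast_ne_zero.2 (by omega)
  have hg0 : aeval w (derivative (pqn X (2 * h + 1))) ≠ 0 := by
    intro h0
    rw [h0, mul_zero] at hg'
    exact hp0 hg'.symm
  have hm0 : (m : ℂ) ≠ 0 := Nat.cast_ne_zero.2 (by omega)
  rw [hQ]
  have hcomp : ∀ r : ℚ[X], aeval z (r.comp (X ^ m)) = aeval w r := fun r => by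
    simp [aeval_comp, hw]
  have hcomp' : ∀ r : ℚ[X], aeval z (derivative (r.comp (X ^ m))) =
      m * z ^ (m - 1) * aeval w (derivative r) := fun r => by
    rw [derivative_comp, map_mul, hcomp]
    simp [derivative_X_pow]
  have hc0 : (m : ℂ) * z ^ (m - 1) ≠ 0 := mul_ne_zero hm0 (pow_ne_zero _ hz0)
  refine (hasValueAt_div_of_derivative hp hz (by rw [hcomp]; simp [hfw])
    (by rw [hcomp, hgw]) (by rw [hcomp']; exact mul_ne_zero hc0 hg0)).congr_value ?_
  rw [hcomp', hcomp', mul_div_mul_left _ _ hc0, div_eq_iff hg0]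
  rw [sum_mul_pow_div_one_add_pow hp hwp] at hf'
  refine mul_left_cancel₀ hw0 ?_
  simp only [derivative_sub, derivative_one, sub_zero, pow_mul z m, mul_left_comm 2 m, ← hw]
  rw [hf', ← hg']
  ring

end FermatQuotient

section GaussReduction

variable {p : ℕ} {z : ℂ}

lemma res_natCast_mul (p j m : ℕ) : res p ((j : ℤ) * m) = ((m : ZMod p) * (j : ZMod p)).val := by
  rw [res, ← Nat.cast_mul, ← Int.natCast_mod, Int.toNat_natCast, ← Nat.cast_mul, ZMod.val_natCast,
    mul_comm]

lemma one_div_one_sub_sq_pow_natAbs_valMinAbs (hp : p.Prime) (hp2 : p ≠ 2)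
    (hz : IsPrimitiveRoot z p) {m j : ℕ} (hmj : ¬ p ∣ m * j) :
    1 / (1 - z ^ (2 * ((m : ZMod p) * (j : ZMod p)).valMinAbs.natAbs)) =
      if p < 2 * res p ((j : ℤ) * m) then 1 - 1 / (1 - z ^ (2 * (m * j)))
      else 1 / (1 - z ^ (2 * (m * j))) := by
  have : NeZero p := ⟨hp.ne_zero⟩
  have hodd := hp.eq_two_or_odd.resolve_left hp2
  have hcast := ZMod.natCast_natAbs_valMinAbs ((m : ZMod p) * (j : ZMod p))
  rw [res_natCast_mul]
  generalize ((m : ZMod p) * (j : ZMod p)).valMinAbs.natAbs = k at hcast ⊢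
  by_cases hv : p < 2 * ((m : ZMod p) * (j : ZMod p)).val
  · rw [if_neg (by omega), eq_neg_iff_add_eq_zero] at hcast
    rw [if_pos hv]
    have hd : p ∣ k + m * j := by
      rw [← ZMod.natCast_eq_zero_iff]
      exact_mod_cast hcast
    have hinv : z ^ (2 * k) * z ^ (2 * (m * j)) = 1 := by
      rw [← pow_add, ← mul_add, hz.pow_eq_one_iff_dvd]
      exact hd.mul_left 2
    have h1 : 1 - z ^ (2 * (m * j)) ≠ 0 := one_sub_pow_ne_zero hz fun h =>
      hmj (((Nat.coprime_primes hp Nat.prime_two).2 hp2).dvd_of_dvd_mul_left h)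
    have h2 : 1 - z ^ (2 * k) ≠ 0 := fun h => h1 (by
      rw [← sub_eq_zero.1 h, one_mul] at hinv
      rw [hinv, sub_self])
    rw [one_sub_div h1, div_eq_div_iff h2 h1]
    linear_combination -hinv
  · rw [if_pos (by omega)] at hcast
    rw [if_neg hv]
    have hmod : k ≡ m * j [MOD p] := by
      rw [← ZMod.natCast_eq_natCast_iff]
      exact_mod_cast hcast
    rw [pow_eq_pow_mod _ hz.pow_eq_one, hmod.mul_left 2, ← pow_eq_pow_mod _ hz.pow_eq_one]

lemma sum_one_div_one_sub_sq_pow_sub (hp : p.Prime) (hp2 : p ≠ 2) (hz : IsPrimitiveRoot z p)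
    {m : ℕ} (hpm : ¬ p ∣ m) :
    ∑ j ∈ Icc 1 ((p - 1) / 2), 1 / (1 - z ^ (2 * (m * j))) -
        ∑ j ∈ Icc 1 ((p - 1) / 2), 1 / (1 - z ^ (2 * j)) =
      ∑ j ∈ Rset p m, (2 * (1 / (1 - z ^ (2 * (m * j)))) - 1) := by
  have := Fact.mk hp
  have hodd := hp.eq_two_or_odd.resolve_left hp2
  have hIco : Ico 1 (p / 2).succ = Icc 1 ((p - 1) / 2) := by
    ext
    simp only [mem_Ico, mem_Icc]
    omega
  have hgauss := ZMod.Ico_map_valMinAbs_natAbs_eq_Ico_map_id p (m : ZMod p)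
    (by rwa [Ne, ZMod.natCast_eq_zero_iff])
  have hsum := congrArg (fun s => (s.map fun j => 1 / (1 - z ^ (2 * j))).sum) hgauss
  simp only [Multiset.map_map, Function.comp_def, hIco] at hsum
  change ∑ j ∈ Icc 1 ((p - 1) / 2), _ = ∑ j ∈ Icc 1 ((p - 1) / 2), _ at hsum
  rw [← hsum, Rset, sum_filter, ← sum_sub_distrib]
  refine sum_congr rfl fun j hj => ?_
  have hj := mem_Icc.1 hj
  have hmj : ¬ p ∣ m * j := fun h => (hp.dvd_mul.1 h).elim hpm
    (not_dvd_of_pos_of_lt (by omega) (by omega))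
  rw [one_div_one_sub_sq_pow_natAbs_valMinAbs hp hp2 hz hmj]
  split_ifs <;> ring

end GaussReduction

theorem sum_Rset_q_pow_congruence (p : ℕ) (hp : p.Prime) (hp5 : 5 ≤ p)
    (m : ℕ) (hm : 1 ≤ m) (hpm : ¬ p ∣ m) :
    qCong (pqn Polynomial.X p)
      (∑ j ∈ Rset p (m : ℤ), q ^ (2 * j * m) / qn (q ^ 2) (j * m))
      ((1 + q) / 2 * QF p 2 q -
        (1 + q ^ m) / (2 * qn (q ^ 2) m) * QF p 2 (q ^ m) -
        ((Rset p (m : ℤ)).card : RatFunc ℚ) / 2 * (1 - q ^ 2)) := by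
  obtain ⟨h, rfl⟩ : ∃ h, p = 2 * h + 1 := hp.odd_of_ne_two (by omega)
  have hp2 : 2 * h + 1 ≠ 2 := by omega
  set z : ℂ := Complex.exp (2 * Real.pi * Complex.I / (2 * h + 1 : ℕ))
  have hz : IsPrimitiveRoot z (2 * h + 1) := Complex.isPrimitiveRoot_exp _ hp.ne_zero
  have hnd2 : ∀ k, ¬ 2 * h + 1 ∣ k → ¬ 2 * h + 1 ∣ 2 * k := fun k hk h' =>
    hk (((Nat.coprime_primes hp Nat.prime_two).2 hp2).dvd_of_dvd_mul_left h')
  have hz2 : 1 - z ^ 2 ≠ 0 := one_sub_pow_ne_zero hz (not_dvd_of_pos_of_lt (by omega) (by omega))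
  have hgeom : ∀ k, ∑ i ∈ range k, (z ^ 2) ^ i = (1 - z ^ (2 * k)) / (1 - z ^ 2) := fun k => by
    rw [eq_div_iff hz2, geom_sum_mul_neg, ← pow_mul]
  have hgeom0 : ∀ k, ¬ 2 * h + 1 ∣ k → ∑ i ∈ range k, (z ^ 2) ^ i ≠ 0 := fun k hk => by
    rw [hgeom]
    exact div_ne_zero (one_sub_pow_ne_zero hz (hnd2 k hk)) hz2
  have hR : ∀ j ∈ Rset (2 * h + 1) m, ¬ 2 * h + 1 ∣ j * m := fun j hj hd => by
    have hj := mem_Icc.1 (mem_filter.1 hj).1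
    exact (hp.dvd_mul.1 hd).elim (not_dvd_of_pos_of_lt (by omega) (by omega)) hpm
  have hq := HasValueAt.indeterminate z
  have hleft := HasValueAt.sum (Rset (2 * h + 1) m) fun j hj =>
    (hq.pow (2 * j * m)).div ((hq.pow 2).qn (j * m)) (hgeom0 _ (hR j hj))
  have htwo : HasValueAt z 2 2 := by simpa using HasValueAt.const z 2
  have hQ1 := hasValueAt_QF_two hp hz le_rfl hp.not_dvd_one
  rw [pow_one, pow_one] at hQ1
  have hright := (((((HasValueAt.one z).add hq).div htwo two_ne_zero).mul hQ1).sub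
    ((((HasValueAt.one z).add (hq.pow m)).div (htwo.mul ((hq.pow 2).qn m))
      (mul_ne_zero two_ne_zero (hgeom0 m hpm))).mul (hasValueAt_QF_two hp hz hm hpm))).sub
    (((HasValueAt.const z (Rset (2 * h + 1) m).card).div htwo two_ne_zero).mul
      ((HasValueAt.one z).sub (hq.pow 2)))
  refine qCong_of_hasValueAt hp hz (hleft.congr_value ?_) hright
  have hIcc : ∀ u : ℕ → ℂ, ∑ j ∈ range h, u (j + 1) = ∑ j ∈ Icc 1 ((2 * h + 1 - 1) / 2), u j := by
    intro u
    rw [range_eq_Ico, sum_Ico_add' u 0 h 1]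
    congr 1
    ext
    simp only [mem_Ico, mem_Icc]
    omega
  have hsum := sum_one_div_one_sub_sq_pow_sub hp hp2 hz hpm
  rw [← hIcc fun j => 1 / (1 - z ^ (2 * (m * j))), ← hIcc fun j => 1 / (1 - z ^ (2 * j)),
    sum_sub_distrib, ← mul_sum, sum_const, nsmul_eq_mul, mul_one] at hsum
  have hterm : ∀ j ∈ Rset (2 * h + 1) m, z ^ (2 * j * m) / ∑ i ∈ range (j * m), (z ^ 2) ^ i =
      (1 - z ^ 2) * (1 / (1 - z ^ (2 * (m * j))) - 1) := fun j hj => by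
    have hne := one_sub_pow_ne_zero hz (hnd2 _ (hR j hj))
    rw [hgeom, mul_assoc, mul_comm m j]
    field_simp
    ring
  rw [sum_congr rfl hterm, ← mul_sum, sum_sub_distrib, sum_const, nsmul_eq_mul, mul_one, hgeom]
  have hzm := one_sub_pow_ne_zero hz (hnd2 m hpm)
  have hcoef : (1 + z ^ m) / (2 * ((1 - z ^ (2 * m)) / (1 - z ^ 2))) * (1 - z ^ m) =
      (1 - z ^ 2) / 2 := by
    field_simp
    ring
  simp only [one_mul]
  linear_combination (-(1 - z ^ 2) / 2) * hsum -
    (∑ j ∈ range h, 1 / (1 - z ^ (2 * (m * (j + 1))))) * hcoef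
end

section
/- Let p ≥ 5 be a prime and m ≥ 2 an integer with p ∤ m. Then (−1)^{Σ_{k=1}^{⌊m/2⌋} ⌊kp/m⌋} = (−1)^{((p−1)/2)·⌊m/2⌋} · (m/p) · (2/p)^{m−1}; equivalently, Σ_{k=1}^{⌊m/2⌋} ⌊kp/m⌋ ≡ ((p−1)/2)·⌊m/2⌋ + (p^2−1)(m−1)/8 − |R_p(m)| (mod 2). -/
open Polynomial Finset

theorem legendreSym_natCast_eq_neg_one_pow {p : ℕ} [Fact p.Prime] (hp : p ≠ 2) {m : ℕ}
    (hm : 1 ≤ m) (hpm : ¬ p ∣ m) :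
    legendreSym p m = (-1) ^ (∑ x ∈ Finset.Icc 1 (p / 2), x * m / p +
      (m - 1) * ∑ x ∈ Finset.Icc 1 (p / 2), x) := by
  have hpos : 0 < p := (Fact.out : p.Prime).pos
  have hodd : p % 2 = 1 := (Nat.Prime.mod_two_eq_one_iff_ne_two Fact.out).mpr hp
  have hm0 : (m : ZMod p) ≠ 0 := by rwa [Ne, ZMod.natCast_eq_zero_iff]
  rcases Nat.mod_two_eq_zero_or_one m with h | h
  · have hmp0 : ((m + p : ℕ) : ZMod p) ≠ 0 := by simpa using hm0
    have key := ZMod.eisenstein_lemma hp (a := m + p) (by omega) hmp0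
    have hsum : ∑ x ∈ Finset.Ico 1 (p / 2).succ, x * (m + p) / p =
        ∑ x ∈ Finset.Icc 1 (p / 2), x * m / p + ∑ x ∈ Finset.Icc 1 (p / 2), x := by
      rw [← Finset.sum_add_distrib]
      refine Finset.sum_congr (by ext; simp) fun x _ => ?_
      rw [mul_add, Nat.add_mul_div_right _ _ hpos]
    have hsym : legendreSym p ((m + p : ℕ) : ℤ) = legendreSym p m := by
      simp [legendreSym]
    rw [← hsym, key, hsum, pow_add, pow_add, pow_mul, Odd.neg_one_pow (n := m - 1)]
    rw [Nat.odd_iff]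
    omega
  · have hIcc : Finset.Ico 1 (p / 2).succ = Finset.Icc 1 (p / 2) := by ext; simp
    rw [ZMod.eisenstein_lemma hp h hm0, hIcc, pow_add, pow_mul, Even.neg_one_pow (n := m - 1),
      one_pow, mul_one]
    rw [Nat.even_iff]
    omega

theorem legendreSym_two_eq_neg_one_pow_sum {p : ℕ} [Fact p.Prime] (hp : p ≠ 2) :
    legendreSym p 2 = (-1) ^ ∑ x ∈ Finset.Icc 1 (p / 2), x := by
  have hodd : p % 2 = 1 := (Nat.Prime.mod_two_eq_one_iff_ne_two Fact.out).mpr hp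
  have h2 : ¬ p ∣ 2 := by rwa [Nat.prime_dvd_prime_iff_eq Fact.out Nat.prime_two]
  have hzero : ∑ x ∈ Finset.Icc 1 (p / 2), x * 2 / p = 0 := by
    refine Finset.sum_eq_zero fun x hx => Nat.div_eq_of_lt ?_
    have := (Finset.mem_Icc.mp hx).2
    omega
  simpa [hzero] using legendreSym_natCast_eq_neg_one_pow hp one_le_two h2

theorem eight_mul_sum_Icc_half {p : ℕ} (hodd : p % 2 = 1) :
    8 * ((∑ x ∈ Finset.Icc 1 (p / 2), x : ℕ) : ℤ) = (p : ℤ) ^ 2 - 1 := by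
  have gauss (n : ℕ) : 2 * ∑ x ∈ Finset.Icc 1 n, x = n * (n + 1) := by
    induction n with
    | zero => simp
    | succ n ih => rw [Finset.sum_Icc_succ_top (by omega), mul_add, ih]; ring
  have hp : (p : ℤ) = 2 * (p / 2 : ℕ) + 1 := by omega
  have h : (2 : ℤ) * ((∑ x ∈ Finset.Icc 1 (p / 2), x : ℕ) : ℤ) =
      (p / 2 : ℕ) * ((p / 2 : ℕ) + 1) := by exact_mod_cast gauss (p / 2)
  rw [hp]
  linear_combination 4 * h

theorem legendreSym_eq_neg_one_pow_card_Rset {p : ℕ} [Fact p.Prime] (hp : p ≠ 2) {a : ℤ}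
    (ha : (a : ZMod p) ≠ 0) : legendreSym p a = (-1) ^ (Rset p a).card := by
  have hodd : p % 2 = 1 := (Nat.Prime.mod_two_eq_one_iff_ne_two Fact.out).mpr hp
  rw [ZMod.gauss_lemma hp ha]
  congr 2
  ext x
  have hval : ((((a : ZMod p) * (x : ZMod p)).val : ℕ) : ℤ) = (x : ℤ) * a % p := by
    rw [mul_comm (x : ℤ), ← ZMod.val_intCast]
    push_cast
    rfl
  rw [Rset, Finset.mem_filter, Finset.mem_filter, Finset.mem_Ico, Finset.mem_Icc, res, ← hval,
    Int.toNat_natCast]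
  omega

theorem sign_identity (p : ℕ) [Fact p.Prime] (hp5 : 5 ≤ p)
    (m : ℕ) (hm : 2 ≤ m) (hpm : ¬ p ∣ m) :
    ((-1 : ℤ) ^ (∑ k ∈ Finset.Icc 1 (m / 2), k * p / m) =
      (-1 : ℤ) ^ (((p - 1) / 2) * (m / 2)) * legendreSym p m *
        legendreSym p 2 ^ (m - 1)) ∧
    ((∑ k ∈ Finset.Icc 1 (m / 2), ((k * p / m : ℕ) : ℤ)) ≡
      ((p - 1) / 2 : ℕ) * ((m / 2 : ℕ) : ℤ) + ((p : ℤ) ^ 2 - 1) * ((m : ℤ) - 1) / 8 -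
        (Rset p (m : ℤ)).card [ZMOD 2]) := by
  have hp : p ≠ 2 := by omega
  have hodd : p % 2 = 1 := (Nat.Prime.mod_two_eq_one_iff_ne_two Fact.out).mpr hp
  have hm0 : (m : ZMod p) ≠ 0 := by rwa [Ne, ZMod.natCast_eq_zero_iff]
  have hIcc (n : ℕ) : Finset.Ico 1 n.succ = Finset.Icc 1 n := by ext; simp
  have hrect := ZMod.sum_mul_div_add_sum_mul_div_eq_mul p m hm0
  have hcard := legendreSym_eq_neg_one_pow_card_Rset hp (a := m) (by simpa using hm0)
  have hleg := legendreSym_natCast_eq_neg_one_pow hp (by omega : 1 ≤ m) hpm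
  have h8 := eight_mul_sum_Icc_half hodd
  rw [hIcc, hIcc] at hrect
  rw [hleg] at hcard
  rw [hleg, legendreSym_two_eq_neg_one_pow_sum hp, ← Nat.cast_sum,
    show (p - 1) / 2 = p / 2 by omega, ← hrect, ← h8, ← pow_mul, ← pow_add, ← pow_add]
  generalize ∑ x ∈ Finset.Icc 1 (p / 2), x * m / p = T at *
  generalize ∑ x ∈ Finset.Icc 1 (m / 2), x * p / m = U at *
  generalize ∑ x ∈ Finset.Icc 1 (p / 2), x = S at *
  generalize (Rset p (m : ℤ)).card = c at *
  have hdiv : 8 * (S : ℤ) * ((m : ℤ) - 1) / 8 = ((m - 1) * S : ℕ) := by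
    rw [mul_assoc, Int.mul_ediv_cancel_left _ (by norm_num), Nat.cast_mul,
      Nat.cast_sub (by omega : 1 ≤ m), Nat.cast_one, mul_comm]
  rw [mul_comm S (m - 1), hdiv, ← Nat.cast_mul, ← hrect]
  generalize (m - 1) * S = V at *
  constructor
  · rw [show T + U + (T + V) + V = U + 2 * (T + V) by ring, pow_add, pow_mul]
    simp
  · have hparity : (T + V) % 2 = c % 2 := by
      rcases Nat.even_or_odd (T + V) with h | h <;> rcases Nat.even_or_odd c with h' | h' <;>
        rw [h.neg_one_pow, h'.neg_one_pow] at hcard <;> grind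
    rw [Int.ModEq]
    omega
end
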